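/- arXiv:1811.11463 — 6 statements merged into one kernel-verified Lean document; each statement's English description precedes it below -/
import Mathlib

section
/- For each n ∈ ℕ define f_n : 𝔻̄ → ℝ on the closed unit disk 𝔻̄ = {(x,y) ∈ ℝ² : x² + y² ≤ 1} by f_n(x, y) = sin(nx)(1 − x² − y²). Then lim_{n→∞} ∫_𝔻 (1 + (∂_y f_n)²)/√(1 + (∂_x f_n)² + (∂_y f_n)²) dx dy = 0, where the integral is over the open unit disk with respect to Lebesgue measure on ℝ². -/
open MeasureTheory Filter

lemma aux_deriv (n : ℝ) (p v : ℝ × ℝ) :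
    fderiv ℝ (fun q : ℝ × ℝ => Real.sin (n * q.1) * (1 - q.1 ^ 2 - q.2 ^ 2)) p v =
      n * v.1 * Real.cos (n * p.1) * (1 - p.1 ^ 2 - p.2 ^ 2)
        - (2 * p.1 * v.1 + 2 * p.2 * v.2) * Real.sin (n * p.1) := by
  have h1 : HasFDerivAt (fun q : ℝ × ℝ => q.1) (ContinuousLinearMap.fst ℝ ℝ ℝ) p :=
    hasFDerivAt_fst
  have h2 : HasFDerivAt (fun q : ℝ × ℝ => q.2) (ContinuousLinearMap.snd ℝ ℝ ℝ) p :=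
    hasFDerivAt_snd
  have h := ((h1.const_mul n).sin).mul (((h1.pow 2).const_sub 1).sub (h2.pow 2))
  have h' := h.fderiv
  rw [show (fun q : ℝ × ℝ => Real.sin (n * q.1) * (1 - q.1 ^ 2 - q.2 ^ 2)) = _ from rfl]
  erw [h']
  simp
  ring

lemma aux_tendsto (a : ℝ) (ha : 0 < a) :
    Tendsto (fun n : ℕ => 1 / Real.sqrt (1 + n * a)) atTop (nhds 0) := by
  have h1 : Tendsto (fun n : ℕ => 1 + (n : ℝ) * a) atTop atTop :=
    tendsto_atTop_add_const_left _ _ (tendsto_natCast_atTop_atTop.atTop_mul_const ha)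
  have h2 := (Real.tendsto_sqrt_atTop.comp h1).inv_tendsto_atTop
  refine h2.congr fun n => ?_
  simp

lemma aux_le_one (n : ℕ) (a : ℝ) (ha : 0 ≤ a) : 1 / Real.sqrt (1 + n * a) ≤ 1 := by
  have : 1 ≤ Real.sqrt (1 + n * a) := by
    rw [Real.one_le_sqrt]
    have : 0 ≤ (n : ℝ) * a := by positivity
    linarith
  rw [div_le_one (by linarith)]
  exact this

lemma aux_cont (n : ℕ) {X : Type*} [TopologicalSpace X] {g : X → ℝ} (hg : Continuous g) :
    Continuous (fun x => 1 / Real.sqrt (1 + n * (g x) ^ 2)) := by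
  refine Continuous.div continuous_const (by fun_prop) ?_
  intro x
  positivity

lemma aux_point (n : ℕ) (c s r x y : ℝ) (hcs : s ^ 2 + c ^ 2 = 1) (hxy : x ^ 2 + y ^ 2 < 1) :
    (1 + (2 * y * s) ^ 2) / Real.sqrt (1 + (n * c * r - 2 * x * s) ^ 2 + (2 * y * s) ^ 2) ≤
      15 * (2 * (1 / Real.sqrt (1 + n * r ^ 2)) + 1 / Real.sqrt (1 + n * c ^ 2)) := by
  have hs : s ^ 2 ≤ 1 := by nlinarith [sq_nonneg c]
  have hx : x ^ 2 ≤ 1 := by nlinarith [sq_nonneg y]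
  have hy : y ^ 2 ≤ 1 := by nlinarith [sq_nonneg x]
  have hys : (2 * y * s) ^ 2 ≤ 4 := by
    have := mul_le_mul hy hs (sq_nonneg s) zero_le_one
    nlinarith
  have hxs : (2 * x * s) ^ 2 ≤ 4 := by
    have := mul_le_mul hx hs (sq_nonneg s) zero_le_one
    nlinarith
  have step1 : Real.sqrt (1 + (n * c * r) ^ 2) ≤
      3 * Real.sqrt (1 + (n * c * r - 2 * x * s) ^ 2 + (2 * y * s) ^ 2) := by
    rw [Real.sqrt_le_left (by positivity), mul_pow 3, Real.sq_sqrt (by positivity)]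
    nlinarith [sq_nonneg (n * c * r - 2 * x * s - 2 * x * s), sq_nonneg (2 * y * s),
      sq_nonneg (n * c * r - 2 * x * s)]
  have hA : 0 < Real.sqrt (1 + (n * c * r) ^ 2) := by positivity
  have hB : 0 < Real.sqrt (1 + (n * c * r - 2 * x * s) ^ 2 + (2 * y * s) ^ 2) := by positivity
  have step2 : (1 + (2 * y * s) ^ 2) /
      Real.sqrt (1 + (n * c * r - 2 * x * s) ^ 2 + (2 * y * s) ^ 2) ≤
      15 * (1 / Real.sqrt (1 + (n * c * r) ^ 2)) := by
    rw [mul_one_div, div_le_div_iff₀ hB hA]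
    nlinarith
  refine step2.trans (mul_le_mul_of_nonneg_left ?_ (by norm_num))
  have p1 : 0 < 1 / Real.sqrt (1 + n * r ^ 2) := by positivity
  have p2 : 0 < 1 / Real.sqrt (1 + n * c ^ 2) := by positivity
  rcases le_total 1 (n * r ^ 2) with h | h
  · have : 1 / Real.sqrt (1 + (n * c * r) ^ 2) ≤ 1 / Real.sqrt (1 + n * c ^ 2) := by
      apply one_div_le_one_div_of_le (by positivity)
      apply Real.sqrt_le_sqrt
      have : 0 ≤ (n : ℝ) * c ^ 2 := by positivity
      nlinarith
    linarith
  · have h1 : 1 / Real.sqrt (1 + (n * c * r) ^ 2) ≤ 1 := by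
      rw [div_le_one hA, Real.one_le_sqrt]
      nlinarith [sq_nonneg (n * c * r)]
    have h2 : 1 ≤ 2 * (1 / Real.sqrt (1 + n * r ^ 2)) := by
      rw [mul_one_div, one_le_div (by positivity), Real.sqrt_le_left (by norm_num)]
      linarith
    linarith

lemma aux_cos : Tendsto (fun n : ℕ => ∫ u in (0 : ℝ)..Real.pi,
    1 / Real.sqrt (1 + n * (Real.cos u) ^ 2)) atTop (nhds 0) := by
  have h := intervalIntegral.tendsto_integral_filter_of_dominated_convergence
    (μ := volume) (a := 0) (b := Real.pi) (l := atTop)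
    (F := fun (n : ℕ) u => 1 / Real.sqrt (1 + n * (Real.cos u) ^ 2)) (f := fun _ => 0)
    (fun _ => (1 : ℝ)) ?_ ?_ ?_ ?_
  · simpa using h
  · exact Eventually.of_forall fun n =>
      (aux_cont n Real.continuous_cos).aestronglyMeasurable
  · refine Eventually.of_forall fun n => Eventually.of_forall fun u _ => ?_
    rw [Real.norm_of_nonneg (by positivity)]
    exact aux_le_one n _ (sq_nonneg _)
  · simp
  · have : ∀ᵐ u : ℝ, u ≠ Real.pi / 2 := by
      simp [ae_iff]
    filter_upwards [this] with u hu hu2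
    rw [Set.uIoc_of_le Real.pi_pos.le] at hu2
    apply aux_tendsto
    apply sq_pos_of_ne_zero
    intro h0
    apply hu
    apply Real.injOn_cos ⟨hu2.1.le, hu2.2⟩ ⟨by positivity, by linarith [Real.pi_pos]⟩
    rw [h0, Real.cos_pi_div_two]

lemma aux_period (n : ℕ) (hn : 0 < n) :
    ∫ x in (-1 : ℝ)..1, 1 / Real.sqrt (1 + n * (Real.cos (n * x)) ^ 2) ≤
      2 * ∫ u in (0 : ℝ)..Real.pi, 1 / Real.sqrt (1 + n * (Real.cos u) ^ 2) := by
  set g : ℝ → ℝ := fun u => 1 / Real.sqrt (1 + n * (Real.cos u) ^ 2) with hg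
  have hc : Continuous g := aux_cont n Real.continuous_cos
  have hn' : (0 : ℝ) < n := by exact_mod_cast hn
  have hp : Function.Periodic g Real.pi := by
    intro u
    simp [hg, Real.cos_add_pi]
  have h1 : ∫ x in (-1 : ℝ)..1, g (n * x) = (n : ℝ)⁻¹ * ∫ u in (-n : ℝ)..n, g u := by
    rw [intervalIntegral.integral_comp_mul_left _ hn'.ne']
    simp
  have h2 : ∫ u in (-n : ℝ)..n, g u ≤ ∫ u in (-(n * Real.pi) : ℝ)..(n * Real.pi), g u := by
    have : (n : ℝ) ≤ n * Real.pi := by nlinarith [Real.pi_gt_three]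
    apply intervalIntegral.integral_mono_interval (by linarith) (by linarith) this
    · exact Eventually.of_forall fun u => by simp only [hg]; positivity
    · exact hc.intervalIntegrable _ _
  have h3 : ∫ u in (-(n * Real.pi) : ℝ)..(n * Real.pi), g u =
      2 * n * ∫ u in (0 : ℝ)..Real.pi, g u := by
    have := hp.intervalIntegral_add_zsmul_eq (2 * n : ℤ) (-(n * Real.pi))
      (fun _ _ => hc.intervalIntegrable _ _)
    simp only [zsmul_eq_mul] at this
    rw [show -(n * Real.pi) + (((2 * n : ℤ)) : ℝ) * Real.pi = n * Real.pi by push_cast; ring]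
      at this
    rw [this, hp.intervalIntegral_add_eq _ 0]
    push_cast
    simp
  change ∫ x in (-1 : ℝ)..1, g (n * x) ≤ 2 * ∫ u in (0 : ℝ)..Real.pi, g u
  rw [h1]
  rw [h3] at h2
  calc _ ≤ (n : ℝ)⁻¹ * (2 * n * ∫ u in (0 : ℝ)..Real.pi, g u) :=
        mul_le_mul_of_nonneg_left h2 (by positivity)
    _ = _ := by field_simp

lemma aux_sub : {p : ℝ × ℝ | p.1 ^ 2 + p.2 ^ 2 < 1} ⊆
    (Set.Icc (-1 : ℝ) 1) ×ˢ (Set.Icc (-1 : ℝ) 1) := by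
  intro p hp
  have hp : p.1 ^ 2 + p.2 ^ 2 < 1 := hp
  refine ⟨abs_le.1 ?_, abs_le.1 ?_⟩
  · rw [← sq_le_one_iff_abs_le_one]; nlinarith [sq_nonneg p.2]
  · rw [← sq_le_one_iff_abs_le_one]; nlinarith [sq_nonneg p.1]

lemma aux_meas : MeasurableSet {p : ℝ × ℝ | p.1 ^ 2 + p.2 ^ 2 < 1} :=
  (isOpen_lt (by fun_prop) (by fun_prop)).measurableSet

lemma aux_int {g : ℝ × ℝ → ℝ} (hg : Continuous g) :
    IntegrableOn g ((Set.Icc (-1 : ℝ) 1) ×ˢ (Set.Icc (-1 : ℝ) 1)) :=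
  hg.continuousOn.integrableOn_compact (isCompact_Icc.prod isCompact_Icc)

lemma aux_r : Tendsto (fun n : ℕ => ∫ p in {p : ℝ × ℝ | p.1 ^ 2 + p.2 ^ 2 < 1},
    1 / Real.sqrt (1 + n * (1 - p.1 ^ 2 - p.2 ^ 2) ^ 2)) atTop (nhds 0) := by
  have h := tendsto_integral_of_dominated_convergence
    (μ := volume.restrict {p : ℝ × ℝ | p.1 ^ 2 + p.2 ^ 2 < 1})
    (F := fun (n : ℕ) p => 1 / Real.sqrt (1 + n * (1 - p.1 ^ 2 - p.2 ^ 2) ^ 2))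
    (f := fun _ => 0)
    (fun _ => (1 : ℝ)) ?_ ?_ ?_ ?_
  · simpa using h
  · exact fun n => (aux_cont n (by fun_prop)).aestronglyMeasurable
  · exact (aux_int continuous_const).mono_set aux_sub
  · refine fun n => Eventually.of_forall fun u => ?_
    rw [Real.norm_of_nonneg (by positivity)]
    exact aux_le_one n _ (sq_nonneg _)
  · filter_upwards [ae_restrict_mem aux_meas] with p hp
    apply aux_tendsto
    have hp : p.1 ^ 2 + p.2 ^ 2 < 1 := hp
    have : 0 < 1 - p.1 ^ 2 - p.2 ^ 2 := by linarith
    positivity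

lemma aux_c (n : ℕ) (hn : 0 < n) : ∫ p in {p : ℝ × ℝ | p.1 ^ 2 + p.2 ^ 2 < 1},
    1 / Real.sqrt (1 + n * (Real.cos (n * p.1)) ^ 2) ≤
    4 * ∫ u in (0 : ℝ)..Real.pi, 1 / Real.sqrt (1 + n * (Real.cos u) ^ 2) := by
  have hc : Continuous fun p : ℝ × ℝ => 1 / Real.sqrt (1 + n * (Real.cos (n * p.1)) ^ 2) :=
    aux_cont n (by fun_prop)
  have h1 := setIntegral_mono_set (aux_int hc)
    (Eventually.of_forall fun p => by simp only [Pi.zero_apply]; positivity)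
    (Eventually.of_forall aux_sub)
  refine h1.trans ?_
  have h2 := setIntegral_prod_mul (μ := (volume : Measure ℝ)) (ν := (volume : Measure ℝ))
    (fun x => 1 / Real.sqrt (1 + n * (Real.cos (n * x)) ^ 2)) (fun _ => (1 : ℝ))
    (Set.Icc (-1 : ℝ) 1) (Set.Icc (-1 : ℝ) 1)
  simp only [mul_one] at h2
  rw [← Measure.volume_eq_prod] at h2
  rw [h2]
  have h3 := aux_period n hn
  rw [intervalIntegral.integral_of_le (by norm_num), ← integral_Icc_eq_integral_Ioc] at h3
  have h4 : ∫ _ in Set.Icc (-1 : ℝ) 1, (1 : ℝ) = 2 := by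
    simp [measureReal_def]; norm_num
  rw [h4]
  linarith


/-- For `f_n(x, y) = sin(nx)(1 − x² − y²)` on the closed unit disk, the
Dirichlet energy on the graph surface `S_{f_n}` of the restriction of the coordinate
function `(x, y, z) ↦ x`, namely
`∫_𝔻 (1 + (∂_y f_n)²)/√(1 + (∂_x f_n)² + (∂_y f_n)²) dx dy`,
tends to `0` as `n → ∞`. -/
theorem stmt_3 :
    Tendsto (fun n : ℕ =>
      ∫ p in {p : ℝ × ℝ | p.1 ^ 2 + p.2 ^ 2 < 1},
        (1 + (fderiv ℝ (fun q : ℝ × ℝ =>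
            Real.sin (n * q.1) * (1 - q.1 ^ 2 - q.2 ^ 2)) p (0, 1)) ^ 2) /
          Real.sqrt (1 +
            (fderiv ℝ (fun q : ℝ × ℝ =>
              Real.sin (n * q.1) * (1 - q.1 ^ 2 - q.2 ^ 2)) p (1, 0)) ^ 2 +
            (fderiv ℝ (fun q : ℝ × ℝ =>
              Real.sin (n * q.1) * (1 - q.1 ^ 2 - q.2 ^ 2)) p (0, 1)) ^ 2))
      atTop (nhds 0) := by
  have hup : Tendsto (fun n : ℕ => 15 * (2 * (∫ p in {p : ℝ × ℝ | p.1 ^ 2 + p.2 ^ 2 < 1},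
      1 / Real.sqrt (1 + n * (1 - p.1 ^ 2 - p.2 ^ 2) ^ 2)) +
      4 * ∫ u in (0 : ℝ)..Real.pi, 1 / Real.sqrt (1 + n * (Real.cos u) ^ 2)))
      atTop (nhds 0) := by
    simpa using ((aux_r.const_mul 2).add (aux_cos.const_mul 4)).const_mul 15
  refine tendsto_of_tendsto_of_tendsto_of_le_of_le' tendsto_const_nhds hup ?_ ?_
  · exact Eventually.of_forall fun n => integral_nonneg fun p => by
      simp only [Pi.zero_apply]; positivity
  · filter_upwards [eventually_gt_atTop 0] with n hn
    have i1 : IntegrableOn (fun p : ℝ × ℝ =>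
        1 / Real.sqrt (1 + n * (1 - p.1 ^ 2 - p.2 ^ 2) ^ 2))
        {p : ℝ × ℝ | p.1 ^ 2 + p.2 ^ 2 < 1} :=
      (aux_int (aux_cont n (by fun_prop))).mono_set aux_sub
    have i2 : IntegrableOn (fun p : ℝ × ℝ =>
        1 / Real.sqrt (1 + n * (Real.cos (n * p.1)) ^ 2))
        {p : ℝ × ℝ | p.1 ^ 2 + p.2 ^ 2 < 1} :=
      (aux_int (aux_cont n (by fun_prop))).mono_set aux_sub
    have key : _ ≤ ∫ p in {p : ℝ × ℝ | p.1 ^ 2 + p.2 ^ 2 < 1},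
        15 * (2 * (1 / Real.sqrt (1 + n * (1 - p.1 ^ 2 - p.2 ^ 2) ^ 2)) +
          1 / Real.sqrt (1 + n * (Real.cos (n * p.1)) ^ 2)) :=
      integral_mono_of_nonneg
        (f := fun p : ℝ × ℝ => (1 + (fderiv ℝ (fun q : ℝ × ℝ =>
            Real.sin (n * q.1) * (1 - q.1 ^ 2 - q.2 ^ 2)) p (0, 1)) ^ 2) /
          Real.sqrt (1 +
            (fderiv ℝ (fun q : ℝ × ℝ =>
              Real.sin (n * q.1) * (1 - q.1 ^ 2 - q.2 ^ 2)) p (1, 0)) ^ 2 +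
            (fderiv ℝ (fun q : ℝ × ℝ =>
              Real.sin (n * q.1) * (1 - q.1 ^ 2 - q.2 ^ 2)) p (0, 1)) ^ 2))
        (Eventually.of_forall fun p => by simp only [Pi.zero_apply]; positivity)
        (((i1.const_mul 2).add i2).const_mul 15) (by
          filter_upwards [ae_restrict_mem aux_meas] with p hp
          have := aux_point n (Real.cos (n * p.1)) (Real.sin (n * p.1))
            (1 - p.1 ^ 2 - p.2 ^ 2) p.1 p.2 (Real.sin_sq_add_cos_sq _) hp
          rw [aux_deriv, aux_deriv]
          have e1 : (n : ℝ) * ((0 : ℝ), (1 : ℝ)).1 * Real.cos (n * p.1) * (1 - p.1 ^ 2 - p.2 ^ 2)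
              - (2 * p.1 * ((0 : ℝ), (1 : ℝ)).1 + 2 * p.2 * ((0 : ℝ), (1 : ℝ)).2)
                * Real.sin (n * p.1) = -(2 * p.2 * Real.sin (n * p.1)) := by
            dsimp only
            ring
          have e2 : (n : ℝ) * ((1 : ℝ), (0 : ℝ)).1 * Real.cos (n * p.1) * (1 - p.1 ^ 2 - p.2 ^ 2)
              - (2 * p.1 * ((1 : ℝ), (0 : ℝ)).1 + 2 * p.2 * ((1 : ℝ), (0 : ℝ)).2)
                * Real.sin (n * p.1) = n * Real.cos (n * p.1) * (1 - p.1 ^ 2 - p.2 ^ 2)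
                  - 2 * p.1 * Real.sin (n * p.1) := by
            dsimp only
            ring
          rw [e1, e2, neg_sq]
          exact this)
    refine key.trans ?_
    rw [integral_const_mul, integral_add (i1.const_mul 2) i2, integral_const_mul]
    have := aux_c n hn
    linarith
end

section
/- Let F : ℝ → ℝ be the 4-periodic function with F(t) = 1 − t for t ∈ [0,2] and F(t) = t − 3 for t ∈ [2,4]. Let n ≥ 1, δ₂ > 0, ω > 0 and q ∈ ℝⁿ, and define g : ℝⁿ → ℝ by g(x) = δ₂ F(ω‖x − q‖). Then g is Lipschitz, and for Lebesgue-almost every x ∈ ℝⁿ, g is differentiable at x with ∇g(x) = ± δ₂ ω (x − q)/‖x − q‖; in particular ‖∇g(x)‖ = δ₂ ω for a.e. x. -/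
open MeasureTheory

lemma saw_periodic (F : ℝ → ℝ) (hFper : ∀ t, F (t + 4) = F t) (t : ℝ) (m : ℤ) :
    F (t - 4 * m) = F t := by
  have h : Function.Periodic F 4 := hFper
  have := h.sub_int_mul_eq (x := t) m
  rw [mul_comm]; exact this

lemma saw_exists (F : ℝ → ℝ) (hFper : ∀ t, F (t + 4) = F t)
    (hF1 : ∀ t ∈ Set.Icc (0 : ℝ) 2, F t = 1 - t)
    (hF2 : ∀ t ∈ Set.Icc (2 : ℝ) 4, F t = t - 3) (t : ℝ) :
    ∃ m : ℤ, F t = |t - 4 * m - 2| - 1 ∧ 0 ≤ t - 4 * m ∧ t - 4 * m ≤ 4 := by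
  refine ⟨⌊t / 4⌋, ?_⟩
  have h1 := Int.floor_le (t / 4)
  have h2 := Int.lt_floor_add_one (t / 4)
  set m := ⌊t / 4⌋
  have a : 0 ≤ t - 4 * m := by linarith
  have b : t - 4 * m ≤ 4 := by linarith
  refine ⟨?_, a, b⟩
  rw [← saw_periodic F hFper t m]
  rcases le_total (t - 4 * m) 2 with h | h
  · rw [hF1 _ ⟨a, h⟩, abs_of_nonpos (by linarith)]; ring
  · rw [hF2 _ ⟨h, b⟩, abs_of_nonneg (by linarith)]; ring

lemma saw_le (F : ℝ → ℝ) (hFper : ∀ t, F (t + 4) = F t)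
    (hF1 : ∀ t ∈ Set.Icc (0 : ℝ) 2, F t = 1 - t)
    (hF2 : ∀ t ∈ Set.Icc (2 : ℝ) 4, F t = t - 3) (t : ℝ) (k : ℤ) :
    F t ≤ |t - 4 * k - 2| - 1 := by
  obtain ⟨m, h, a, b⟩ := saw_exists F hFper hF1 hF2 t
  rw [h]
  rcases lt_trichotomy k m with hk | hk | hk
  · have : (k : ℝ) + 1 ≤ m := by exact_mod_cast hk
    have h1 : |t - 4 * m - 2| ≤ 2 := abs_le.2 ⟨by linarith, by linarith⟩
    have h2 := le_abs_self (t - 4 * k - 2)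
    linarith
  · rw [hk]
  · have : (m : ℝ) + 1 ≤ k := by exact_mod_cast hk
    have h1 : |t - 4 * m - 2| ≤ 2 := abs_le.2 ⟨by linarith, by linarith⟩
    have h2 := neg_abs_le (t - 4 * k - 2)
    linarith

lemma saw_lip (F : ℝ → ℝ) (hFper : ∀ t, F (t + 4) = F t)
    (hF1 : ∀ t ∈ Set.Icc (0 : ℝ) 2, F t = 1 - t)
    (hF2 : ∀ t ∈ Set.Icc (2 : ℝ) 4, F t = t - 3) : LipschitzWith 1 F := by
  refine LipschitzWith.of_le_add fun s t => ?_
  obtain ⟨m, h, -, -⟩ := saw_exists F hFper hF1 hF2 t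
  have h1 := saw_le F hFper hF1 hF2 s m
  have h2 := abs_add_le (t - 4 * m - 2) (s - t)
  rw [show t - 4 * m - 2 + (s - t) = s - 4 * m - 2 by ring] at h2
  rw [Real.dist_eq]
  linarith

lemma saw_deriv (F : ℝ → ℝ) (hFper : ∀ t, F (t + 4) = F t)
    (hF1 : ∀ t ∈ Set.Icc (0 : ℝ) 2, F t = 1 - t)
    (hF2 : ∀ t ∈ Set.Icc (2 : ℝ) 4, F t = t - 3) (t : ℝ) (ht : ∀ m : ℤ, t ≠ 2 * m) :
    HasDerivAt F 1 t ∨ HasDerivAt F (-1) t := by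
  obtain ⟨m, -, a, b⟩ := saw_exists F hFper hF1 hF2 t
  have a0 := ht (2 * m)
  have a1 := ht (2 * m + 1)
  have a2 := ht (2 * m + 2)
  push_cast at a0 a1 a2
  have a' : 4 * (m : ℝ) < t := lt_of_le_of_ne (by linarith) (fun h => a0 (by linarith))
  have b' : t < 4 * (m : ℝ) + 4 := lt_of_le_of_ne (by linarith) (fun h => a2 (by linarith))
  have c' : t ≠ 4 * m + 2 := fun h => a1 (by linarith)
  rcases lt_or_gt_of_ne c' with c | c
  · right
    have : F =ᶠ[nhds t] fun s => 1 - (s - 4 * m) := by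
      filter_upwards [Ioo_mem_nhds a' c] with s hs
      rw [← saw_periodic F hFper s m]
      exact hF1 _ ⟨by linarith [hs.1], by linarith [hs.2]⟩
    exact (((hasDerivAt_id t).sub_const _).const_sub 1).congr_of_eventuallyEq this
  · left
    have : F =ᶠ[nhds t] fun s => (s - 4 * m) - 3 := by
      filter_upwards [Ioo_mem_nhds c b'] with s hs
      rw [← saw_periodic F hFper s m]
      exact hF2 _ ⟨by linarith [hs.1], by linarith [hs.2]⟩
    exact (((hasDerivAt_id t).sub_const _).sub_const 3).congr_of_eventuallyEq this

lemma norm_fderiv_aux {n : ℕ} (q x : EuclideanSpace ℝ (Fin n)) (hx : ‖x - q‖ ≠ 0) :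
    HasFDerivAt (fun y => ‖y - q‖) (‖x - q‖⁻¹ • innerSL ℝ (x - q)) x := by
  have h := (((hasFDerivAt_id x).sub_const q).norm_sq).sqrt (by simpa using hx)
  simp only [id, Real.sqrt_sq (norm_nonneg _)] at h
  refine h.congr_fderiv ?_
  ext v
  simp
  field_simp

lemma grad_aux {n : ℕ} (δ₂ ω c : ℝ) (q x : EuclideanSpace ℝ (Fin n)) (hx : ‖x - q‖ ≠ 0)
    (F : ℝ → ℝ) (g : EuclideanSpace ℝ (Fin n) → ℝ) (hg : ∀ x, g x = δ₂ * F (ω * ‖x - q‖))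
    (hF : HasDerivAt F c (ω * ‖x - q‖)) :
    HasGradientAt g (c • ((δ₂ * ω / ‖x - q‖) • (x - q))) x := by
  rw [hasGradientAt_iff_hasFDerivAt, funext hg]
  have h1 := (norm_fderiv_aux q x hx).const_mul ω
  have h := (hF.comp_hasFDerivAt x h1).const_mul δ₂
  refine h.congr_fderiv ?_
  ext v
  simp [inner_smul_left]
  field_simp

/-- Let `F` be the 4-periodic sawtooth with `F(t) = 1 − t` on `[0,2]` and
`F(t) = t − 3` on `[2,4]`, and let `g(x) = δ₂ F(ω ‖x − q‖)`. Then `g` is Lipschitz and, for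
Lebesgue-almost every `x`, `g` has gradient `± δ₂ ω (x − q)/‖x − q‖` at `x`; in particular
`‖∇g(x)‖ = δ₂ ω` for a.e. `x`. -/
theorem stmt_4 (n : ℕ) (hn : 1 ≤ n) (δ₂ ω : ℝ) (hδ₂ : 0 < δ₂) (hω : 0 < ω)
    (q : EuclideanSpace ℝ (Fin n))
    (F : ℝ → ℝ) (hFper : ∀ t, F (t + 4) = F t)
    (hF1 : ∀ t ∈ Set.Icc (0 : ℝ) 2, F t = 1 - t)
    (hF2 : ∀ t ∈ Set.Icc (2 : ℝ) 4, F t = t - 3)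
    (g : EuclideanSpace ℝ (Fin n) → ℝ) (hg : ∀ x, g x = δ₂ * F (ω * ‖x - q‖)) :
    (∃ K : NNReal, LipschitzWith K g) ∧
    (∀ᵐ x : EuclideanSpace ℝ (Fin n) ∂volume,
      (HasGradientAt g ((δ₂ * ω / ‖x - q‖) • (x - q)) x ∨
        HasGradientAt g (-((δ₂ * ω / ‖x - q‖) • (x - q))) x) ∧
      ‖gradient g x‖ = δ₂ * ω) := by
  constructor
  · refine ⟨(δ₂ * ω).toNNReal, LipschitzWith.of_dist_le_mul fun x y => ?_⟩
    have h := (saw_lip F hFper hF1 hF2).dist_le_mul (ω * ‖x - q‖) (ω * ‖y - q‖)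
    rw [Real.coe_toNNReal _ (by positivity), hg, hg, Real.dist_eq, ← mul_sub, abs_mul,
      abs_of_pos hδ₂, mul_assoc]
    refine mul_le_mul_of_nonneg_left ?_ hδ₂.le
    rw [Real.dist_eq, Real.dist_eq, ← mul_sub, abs_mul, abs_of_pos hω] at h
    have h2 := abs_norm_sub_norm_le (x - q) (y - q)
    rw [sub_sub_sub_cancel_right, ← dist_eq_norm x y] at h2
    have h3 := mul_le_mul_of_nonneg_left h2 hω.le
    simp at h
    linarith
  · haveI : Nonempty (Fin n) := ⟨⟨0, hn⟩⟩
    have hae : ∀ᵐ x : EuclideanSpace ℝ (Fin n) ∂volume, ∀ m : ℤ, ω * ‖x - q‖ ≠ 2 * m := by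
      rw [ae_all_iff]
      intro m
      have := Measure.addHaar_sphere (volume : Measure (EuclideanSpace ℝ (Fin n))) q (2 * m / ω)
      filter_upwards [measure_eq_zero_iff_ae_notMem.1 this] with x hx h
      apply hx
      rw [mem_sphere_iff_norm, eq_div_iff hω.ne']
      linarith
    filter_upwards [hae] with x hx
    have hx0 : ‖x - q‖ ≠ 0 := fun h => hx 0 (by simp [h])
    have hnorm : ‖(δ₂ * ω / ‖x - q‖) • (x - q)‖ = δ₂ * ω := by
      rw [norm_smul, Real.norm_of_nonneg (by positivity)]
      field_simp
    rcases saw_deriv F hFper hF1 hF2 _ hx with h | h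
    · have := grad_aux δ₂ ω 1 q x hx0 F g hg h
      rw [one_smul] at this
      exact ⟨Or.inl this, by rw [this.gradient, hnorm]⟩
    · have := grad_aux δ₂ ω (-1) q x hx0 F g hg h
      rw [neg_one_smul] at this
      exact ⟨Or.inr this, by rw [this.gradient, norm_neg, hnorm]⟩
end

section
/- Let n ≥ 2, let ε, δ₁, δ₂, ω > 0, set δ = δ₁ + δ₂, and let π : ℝⁿ → ℝ^{n−1} be π(x₁, …, xₙ) = (x₂, …, xₙ). Let B = {x ∈ ℝⁿ : δ₁ ≤ x₁ ≤ δ, ‖πx‖ ≤ ε}. Let F : ℝ → ℝ be the 4-periodic function with F(t) = 1 − t on [0,2] and F(t) = t − 3 on [2,4]. Define g(x) = (x₁ − δ₁) F(ω‖πx‖) and h(x) = 1 − ‖πx‖/ε. Then, with ∇g and ∇h the almost-everywhere defined gradients of these Lipschitz functions, ∫_B (‖∇h‖² + ‖∇h‖²‖∇g‖² − ⟨∇h, ∇g⟩²)/√(1 + ‖∇g‖²) dx ≤ 2 ω_{n−1} ε^{n−3} · ln(δ₂ω + √(1 + δ₂²ω²))/ω, where ω_{n−1} is the Lebesgue measure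 of the unit ball of ℝ^{n−1}. -/
open MeasureTheory RealInnerProductSpace

lemma aux_F_shift (F : ℝ → ℝ) (hFper : ∀ t, F (t + 4) = F t) (k : ℤ) (t : ℝ) :
    F t = F (t - 4 * k) := by
  have hp : Function.Periodic F 4 := hFper
  have := hp.sub_int_mul_eq (x := t) k
  rw [← this]; congr 1; ring

lemma aux_F (F : ℝ → ℝ) (hFper : ∀ t, F (t + 4) = F t)
    (hF1 : ∀ t ∈ Set.Icc (0 : ℝ) 2, F t = 1 - t)
    (hF2 : ∀ t ∈ Set.Icc (2 : ℝ) 4, F t = t - 3) (t : ℝ) (ht : ∀ k : ℤ, t ≠ 2 * k) :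
    F t ^ 2 ≤ 1 ∧ ∃ σ : ℝ, σ ^ 2 = 1 ∧ HasDerivAt F σ t := by
  set k : ℤ := ⌊t / 4⌋ with hk
  have h1 : (k : ℝ) ≤ t / 4 := Int.floor_le _
  have h2 : t / 4 < k + 1 := Int.lt_floor_add_one _
  have h3 : t ≠ 4 * k := by
    have := ht (2 * k); push_cast at this; intro h; apply this; linarith
  have h4 : t ≠ 4 * k + 2 := by
    have := ht (2 * k + 1); push_cast at this; intro h; apply this; linarith
  have h5 : 4 * (k : ℝ) < t := lt_of_le_of_ne (by linarith) (Ne.symm h3)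
  rcases lt_or_gt_of_ne h4 with h6 | h6
  · have hF : ∀ s ∈ Set.Ioo (4 * (k : ℝ)) (4 * k + 2), F s = 1 - (s - 4 * k) := by
      intro s hs
      rw [aux_F_shift F hFper k s]
      exact hF1 _ ⟨by linarith [hs.1], by linarith [hs.2]⟩
    refine ⟨?_, -1, by norm_num, ?_⟩
    · rw [hF t ⟨h5, h6⟩]; nlinarith
    · have hd : HasDerivAt (fun s : ℝ => 1 - (s - 4 * k)) (-1) t := by
        simpa using ((hasDerivAt_id t).sub_const (4 * (k : ℝ))).const_sub 1
      apply hd.congr_of_eventuallyEq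
      filter_upwards [Ioo_mem_nhds h5 h6] with s hs using hF s hs
  · have h7 : t < 4 * k + 4 := by linarith
    have hF : ∀ s ∈ Set.Ioo (4 * (k : ℝ) + 2) (4 * k + 4), F s = (s - 4 * k) - 3 := by
      intro s hs
      rw [aux_F_shift F hFper k s]
      exact hF2 _ ⟨by linarith [hs.1], by linarith [hs.2]⟩
    refine ⟨?_, 1, by norm_num, ?_⟩
    · rw [hF t ⟨h6, h7⟩]; nlinarith
    · have hd : HasDerivAt (fun s : ℝ => (s - 4 * k) - 3) 1 t := by
        simpa using ((hasDerivAt_id t).sub_const (4 * (k : ℝ))).sub_const 3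
      apply hd.congr_of_eventuallyEq
      filter_upwards [Ioo_mem_nhds h6 h7] with s hs using hF s hs

lemma aux_norm {m : ℕ} (pr : EuclideanSpace ℝ (Fin (m + 1)) → EuclideanSpace ℝ (Fin m))
    (hpr : ∀ x i, pr x i = x i.succ) (x : EuclideanSpace ℝ (Fin (m + 1))) (hx : pr x ≠ 0) :
    ∃ v : EuclideanSpace ℝ (Fin (m + 1)), ‖v‖ = 1 ∧ v 0 = 0 ∧
      HasFDerivAt (fun y => ‖pr y‖) (innerSL ℝ v) x := by
  let P : EuclideanSpace ℝ (Fin (m + 1)) →ₗ[ℝ] EuclideanSpace ℝ (Fin m) :=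
    { toFun := pr
      map_add' := by intro a b; ext i; simp [hpr]
      map_smul' := by intro a b; ext i; simp [hpr] }
  let L := P.toContinuousLinearMap
  have hL : ∀ y, L y = pr y := fun y => rfl
  have hr : 0 < ‖pr x‖ := norm_pos_iff.2 hx
  have hsum : ∑ i, (pr x i) ^ 2 = ‖pr x‖ ^ 2 := by
    rw [EuclideanSpace.norm_sq_eq]; simp
  refine ⟨WithLp.toLp 2 (Fin.cons 0 (fun i => pr x i / ‖pr x‖)), ?_, ?_, ?_⟩
  · have : ‖(WithLp.toLp 2 (Fin.cons 0 (fun i => pr x i / ‖pr x‖)) :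
        EuclideanSpace ℝ (Fin (m + 1)))‖ ^ 2 = 1 := by
      rw [EuclideanSpace.norm_sq_eq, Fin.sum_univ_succ]
      simp only [Fin.cons_zero, Fin.cons_succ, norm_zero, Real.norm_eq_abs, sq_abs, div_pow]
      rw [← Finset.sum_div, hsum]
      field_simp
      simp
    exact (pow_eq_one_iff_of_nonneg (norm_nonneg _) two_ne_zero).1 this
  · simp
  · have h1 : HasFDerivAt (fun y => ‖pr y‖ ^ 2) (2 • (innerSL ℝ (pr x)).comp L) x :=
      L.hasFDerivAt.norm_sq
    have h2 := h1.sqrt (by positivity)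
    simp only [Real.sqrt_sq (norm_nonneg _)] at h2
    convert! h2 using 1
    ext y
    simp only [innerSL_apply_apply, ContinuousLinearMap.smul_apply, ContinuousLinearMap.comp_apply, hL,
      PiLp.inner_apply, Fin.sum_univ_succ, Fin.cons_zero, Fin.cons_succ, hpr]
    simp [Finset.mul_sum, hpr]
    apply Finset.sum_congr rfl
    intro i _
    field_simp

lemma aux_pointwise {m : ℕ} (ε δ₁ ω : ℝ) (hε : 0 < ε) (hω : 0 < ω)
    (F : ℝ → ℝ) (hFper : ∀ t, F (t + 4) = F t)
    (hF1 : ∀ t ∈ Set.Icc (0 : ℝ) 2, F t = 1 - t)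
    (hF2 : ∀ t ∈ Set.Icc (2 : ℝ) 4, F t = t - 3)
    (pr : EuclideanSpace ℝ (Fin (m + 1)) → EuclideanSpace ℝ (Fin m))
    (hpr : ∀ x i, pr x i = x i.succ)
    (g h : EuclideanSpace ℝ (Fin (m + 1)) → ℝ)
    (hg : ∀ x, g x = (x 0 - δ₁) * F (ω * ‖pr x‖))
    (hh : ∀ x, h x = 1 - ‖pr x‖ / ε) (x : EuclideanSpace ℝ (Fin (m + 1)))
    (hx : ∀ k : ℤ, ‖pr x‖ ≠ 2 * k / ω) :
    (‖gradient h x‖ ^ 2 + ‖gradient h x‖ ^ 2 * ‖gradient g x‖ ^ 2 -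
          ⟪gradient h x, gradient g x⟫ ^ 2) / Real.sqrt (1 + ‖gradient g x‖ ^ 2) ≤
    2 / ε ^ 2 * (Real.sqrt (1 + ((x 0 - δ₁) * ω) ^ 2))⁻¹ := by
  have hx0 : pr x ≠ 0 := by
    have := hx 0; simpa using this
  obtain ⟨v, hv1, hv0, hv⟩ := aux_norm pr hpr x hx0
  obtain ⟨hFb, σ, hσ, hF'⟩ := aux_F F hFper hF1 hF2 (ω * ‖pr x‖) (by
    intro k hk; apply hx k; rw [eq_div_iff hω.ne', ← hk]; ring)
  set e : EuclideanSpace ℝ (Fin (m + 1)) := EuclideanSpace.single 0 1 with he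
  have he1 : ⟪e, e⟫ = 1 := by simp [he]
  have hev : ⟪e, v⟫ = 0 := by simp [he, hv0, EuclideanSpace.inner_single_left]
  have hve : ⟪v, e⟫ = 0 := by rw [real_inner_comm]; exact hev
  have hvv : ⟪v, v⟫ = 1 := by rw [real_inner_self_eq_norm_sq, hv1]; norm_num
  have hgh : gradient h x = (-(1 / ε)) • v := by
    apply HasGradientAt.gradient
    rw [hasGradientAt_iff_hasFDerivAt]
    have : HasFDerivAt h (-((1 / ε) • innerSL ℝ v)) x := by
      have h1 := (hv.const_mul (1 / ε)).const_sub 1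
      have h2 : h = fun y => 1 - 1 / ε * ‖pr y‖ := by
        funext y; rw [hh]; ring
      rw [h2]; exact h1
    convert! this using 1
    ext y
    simp
  have hgg : gradient g x = F (ω * ‖pr x‖) • e + ((x 0 - δ₁) * ω * σ) • v := by
    apply HasGradientAt.gradient
    rw [hasGradientAt_iff_hasFDerivAt]
    have h0 : HasFDerivAt (fun y : EuclideanSpace ℝ (Fin (m + 1)) => y 0 - δ₁)
        (innerSL ℝ e) x := by
      have : (fun y : EuclideanSpace ℝ (Fin (m + 1)) => y 0 - δ₁) =
          fun y => innerSL ℝ e y - δ₁ := by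
        funext y; simp [he, EuclideanSpace.inner_single_left]
      rw [this]
      exact (innerSL ℝ e).hasFDerivAt.sub_const δ₁
    have h1 := hF'.comp_hasFDerivAt x (hv.const_mul ω)
    have h2 := h0.mul h1
    have h3 : g = fun y => (y 0 - δ₁) * F (ω * ‖pr y‖) := funext hg
    rw [h3]
    convert! h2 using 1
    ext y
    simp [inner_add_left, inner_smul_left]
    ring
  have n1 : ‖gradient h x‖ ^ 2 = 1 / ε ^ 2 := by
    rw [hgh, norm_smul, hv1]; simp
  have n2 : ‖gradient g x‖ ^ 2 = F (ω * ‖pr x‖) ^ 2 + ((x 0 - δ₁) * ω) ^ 2 := by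
    rw [hgg, ← real_inner_self_eq_norm_sq]
    simp only [inner_add_left, inner_add_right, inner_smul_left, inner_smul_right, he1, hev, hve,
      hvv, conj_trivial]
    linear_combination ((x 0 - δ₁) * ω) ^ 2 * hσ
  have n3 : ⟪gradient h x, gradient g x⟫ ^ 2 = 1 / ε ^ 2 * ((x 0 - δ₁) * ω) ^ 2 := by
    rw [hgg, hgh]
    simp only [inner_add_right, inner_smul_left, inner_smul_right, hve,
      hvv, conj_trivial]
    linear_combination (1 / ε ^ 2 * ((x 0 - δ₁) * ω) ^ 2) * hσ
  rw [n3, n1, n2, ← div_eq_mul_inv]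
  apply div_le_div₀ (by positivity)
  · have : 0 ≤ 1 / ε ^ 2 := by positivity
    have h2 : (2 : ℝ) / ε ^ 2 = 1 / ε ^ 2 * 2 := by ring
    rw [h2]
    nlinarith
  · positivity
  · apply Real.sqrt_le_sqrt
    nlinarith [sq_nonneg (F (ω * ‖pr x‖))]

lemma aux_mp (m : ℕ) (pr : EuclideanSpace ℝ (Fin (m + 1)) → EuclideanSpace ℝ (Fin m))
    (hpr : ∀ x i, pr x i = x i.succ) :
    ∃ φ : EuclideanSpace ℝ (Fin (m + 1)) ≃ᵐ ℝ × EuclideanSpace ℝ (Fin m),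
      MeasurePreserving φ ∧ ∀ x, φ x = (x 0, pr x) := by
  refine ⟨((MeasurableEquiv.toLp 2 (Fin (m + 1) → ℝ)).symm.trans
    (MeasurableEquiv.piFinSuccAbove (fun _ => ℝ) 0)).trans
    (MeasurableEquiv.prodCongr (MeasurableEquiv.refl ℝ) (MeasurableEquiv.toLp 2 (Fin m → ℝ))),
    ?_, ?_⟩
  · exact ((EuclideanSpace.volume_preserving_symm_measurableEquiv_toLp (Fin (m + 1))).trans
      (volume_preserving_piFinSuccAbove (fun _ => ℝ) 0)).trans
      ((MeasurePreserving.id volume).prod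
        (EuclideanSpace.volume_preserving_symm_measurableEquiv_toLp (Fin m)).symm)
  · intro x
    refine Prod.ext rfl ?_
    ext i
    rw [hpr]
    rfl

lemma aux_int_s6 (δ₁ δ₂ ω : ℝ) (hδ₂ : 0 < δ₂) (hω : 0 < ω) :
    ∫ s in Set.Icc δ₁ (δ₁ + δ₂), (Real.sqrt (1 + ((s - δ₁) * ω) ^ 2))⁻¹ =
      Real.log (δ₂ * ω + Real.sqrt (1 + δ₂ ^ 2 * ω ^ 2)) / ω := by
  rw [integral_Icc_eq_integral_Ioc, ← intervalIntegral.integral_of_le (by linarith)]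
  have hd : ∀ s ∈ Set.uIcc δ₁ (δ₁ + δ₂), HasDerivAt
      (fun s => Real.arsinh ((s - δ₁) * ω) / ω) ((Real.sqrt (1 + ((s - δ₁) * ω) ^ 2))⁻¹) s := by
    intro s _
    have h1 : HasDerivAt (fun s : ℝ => (s - δ₁) * ω) ω s := by
      simpa using ((hasDerivAt_id s).sub_const δ₁).mul_const ω
    have h2 := ((Real.hasDerivAt_arsinh ((s - δ₁) * ω)).comp s h1).div_const ω
    convert! h2 using 1
    field_simp
  rw [intervalIntegral.integral_eq_sub_of_hasDerivAt hd]
  · simp [Real.arsinh, mul_pow]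
  · apply Continuous.intervalIntegrable
    apply Continuous.inv₀ (by fun_prop)
    intro s
    positivity

lemma aux_main (m : ℕ) (hm : 1 ≤ m) (ε δ₁ δ₂ ω : ℝ)
    (hε : 0 < ε) (hδ₂ : 0 < δ₂) (hω : 0 < ω)
    (F : ℝ → ℝ) (hFper : ∀ t, F (t + 4) = F t)
    (hF1 : ∀ t ∈ Set.Icc (0 : ℝ) 2, F t = 1 - t)
    (hF2 : ∀ t ∈ Set.Icc (2 : ℝ) 4, F t = t - 3)
    (pr : EuclideanSpace ℝ (Fin (m + 1)) → EuclideanSpace ℝ (Fin m))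
    (hpr : ∀ x i, pr x i = x i.succ)
    (B : Set (EuclideanSpace ℝ (Fin (m + 1))))
    (hB : B = {x | δ₁ ≤ x 0 ∧ x 0 ≤ δ₁ + δ₂ ∧ ‖pr x‖ ≤ ε})
    (g h : EuclideanSpace ℝ (Fin (m + 1)) → ℝ)
    (hg : ∀ x, g x = (x 0 - δ₁) * F (ω * ‖pr x‖))
    (hh : ∀ x, h x = 1 - ‖pr x‖ / ε) :
    (∫ x in B,
        (‖gradient h x‖ ^ 2 + ‖gradient h x‖ ^ 2 * ‖gradient g x‖ ^ 2 -
          ⟪gradient h x, gradient g x⟫ ^ 2) / Real.sqrt (1 + ‖gradient g x‖ ^ 2)) ≤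
      2 * (volume (Metric.ball (0 : EuclideanSpace ℝ (Fin m)) 1)).toReal *
        ε ^ (((m + 1 : ℕ) : ℝ) - 3) *
        (Real.log (δ₂ * ω + Real.sqrt (1 + δ₂ ^ 2 * ω ^ 2)) / ω) := by
  obtain ⟨φ, hφ, hφx⟩ := aux_mp m pr hpr
  haveI : Nonempty (Fin m) := ⟨⟨0, hm⟩⟩
  have hBφ : B = φ ⁻¹' (Set.Icc δ₁ (δ₁ + δ₂) ×ˢ Metric.closedBall 0 ε) := by
    rw [hB]; ext x; simp [hφx, and_assoc]
  let G1 : ℝ → ℝ := fun s => (Real.sqrt (1 + ((s - δ₁) * ω) ^ 2))⁻¹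
  have hG1c : Continuous G1 := by
    apply Continuous.inv₀ (by fun_prop)
    intro s
    positivity
  let G : ℝ × EuclideanSpace ℝ (Fin m) → ℝ := fun p => (2 / ε ^ 2 * G1 p.1) * 1
  have hGc : Continuous G := by fun_prop
  have hGi : IntegrableOn G (Set.Icc δ₁ (δ₁ + δ₂) ×ˢ Metric.closedBall 0 ε) :=
    hGc.continuousOn.integrableOn_compact (isCompact_Icc.prod (isCompact_closedBall _ _))
  have hGi' : IntegrableOn (fun x => G (φ x)) B := by
    rw [hBφ]
    exact (hφ.integrableOn_comp_preimage φ.measurableEmbedding).2 hGi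
  have hae : ∀ᵐ x : EuclideanSpace ℝ (Fin (m + 1)), ∀ k : ℤ, ‖pr x‖ ≠ 2 * k / ω := by
    rw [ae_all_iff]
    intro k
    have hs : volume (Metric.sphere (0 : EuclideanSpace ℝ (Fin m)) (2 * k / ω)) = 0 :=
      Measure.addHaar_sphere _ _ _
    have hq : MeasurePreserving (fun x => φ x) := hφ
    have hs2 : volume ((Set.univ : Set ℝ) ×ˢ
        Metric.sphere (0 : EuclideanSpace ℝ (Fin m)) (2 * k / ω)) = 0 := by
      rw [Measure.volume_eq_prod, Measure.prod_prod, hs, mul_zero]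
    have hs3 := hφ.quasiMeasurePreserving.preimage_null hs2
    rw [ae_iff]
    convert! hs3 using 2
    ext x
    simp [hφx]
  calc _ ≤ ∫ x in B, G (φ x) := by
        apply integral_mono_of_nonneg
        · filter_upwards with x
          apply div_nonneg _ (Real.sqrt_nonneg _)
          have h1 := abs_real_inner_le_norm (gradient h x) (gradient g x)
          have h2 : ⟪gradient h x, gradient g x⟫ ^ 2 ≤
              (‖gradient h x‖ * ‖gradient g x‖) ^ 2 := by
            rw [← sq_abs]
            exact pow_le_pow_left₀ (abs_nonneg _) h1 2
          rw [mul_pow] at h2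
          have := sq_nonneg ‖gradient h x‖
          linarith
        · exact hGi'
        · filter_upwards [ae_restrict_of_ae hae] with x hx
          have := aux_pointwise ε δ₁ ω hε hω F hFper hF1 hF2 pr hpr g h hg hh x hx
          simpa [G, G1, hφx] using this
    _ = ∫ p in Set.Icc δ₁ (δ₁ + δ₂) ×ˢ Metric.closedBall 0 ε, G p := by
        rw [hBφ]
        exact hφ.setIntegral_preimage_emb φ.measurableEmbedding G _
    _ = (∫ s in Set.Icc δ₁ (δ₁ + δ₂), 2 / ε ^ 2 * G1 s) *
          ∫ y in Metric.closedBall (0 : EuclideanSpace ℝ (Fin m)) ε, (1 : ℝ) :=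
        setIntegral_prod_mul (μ := volume) (ν := volume) (fun s => 2 / ε ^ 2 * G1 s)
          (fun _ => (1 : ℝ)) _ _
    _ = _ := by
        rw [integral_const_mul, aux_int_s6 δ₁ δ₂ ω hδ₂ hω, setIntegral_const, 
          Measure.addHaar_real_closedBall _ _ hε.le]
        have : ε ^ (((m + 1 : ℕ) : ℝ) - 3) = ε ^ m / ε ^ 2 := by
          rw [← Real.rpow_natCast ε m, ← Real.rpow_natCast ε 2, ← Real.rpow_sub hε]
          congr 1; push_cast; ring
        rw [this]
        simp only [finrank_euclideanSpace, Fintype.card_fin, measureReal_def, smul_eq_mul]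
        ring

/-- On the cylinder `B = {x : δ₁ ≤ x₁ ≤ δ, ‖πx‖ ≤ ε}`, with
`g(x) = (x₁ − δ₁) F(ω‖πx‖)` (sawtooth `F`) and `h(x) = 1 − ‖πx‖/ε`, the graph
Dirichlet-energy integrand of `h` integrates to at most
`2 ω_{n−1} ε^{n−3} ln(δ₂ω + √(1 + δ₂²ω²))/ω`, where `ω_{n−1}` is the volume of the unit
ball of `ℝ^{n−1}`. -/
theorem stmt_6 (n : ℕ) (hn : 2 ≤ n) (ε δ₁ δ₂ ω : ℝ)
    (hε : 0 < ε) (hδ₁ : 0 < δ₁) (hδ₂ : 0 < δ₂) (hω : 0 < ω)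
    (F : ℝ → ℝ) (hFper : ∀ t, F (t + 4) = F t)
    (hF1 : ∀ t ∈ Set.Icc (0 : ℝ) 2, F t = 1 - t)
    (hF2 : ∀ t ∈ Set.Icc (2 : ℝ) 4, F t = t - 3)
    (pr : EuclideanSpace ℝ (Fin n) → EuclideanSpace ℝ (Fin (n - 1)))
    (hpr : ∀ x i, pr x i = x ⟨i.1 + 1, by have := i.2; omega⟩)
    (B : Set (EuclideanSpace ℝ (Fin n)))
    (hB : B = {x | δ₁ ≤ x ⟨0, by omega⟩ ∧ x ⟨0, by omega⟩ ≤ δ₁ + δ₂ ∧ ‖pr x‖ ≤ ε})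
    (g h : EuclideanSpace ℝ (Fin n) → ℝ)
    (hg : ∀ x, g x = (x ⟨0, by omega⟩ - δ₁) * F (ω * ‖pr x‖))
    (hh : ∀ x, h x = 1 - ‖pr x‖ / ε) :
    (∫ x in B,
        (‖gradient h x‖ ^ 2 + ‖gradient h x‖ ^ 2 * ‖gradient g x‖ ^ 2 -
          ⟪gradient h x, gradient g x⟫ ^ 2) / Real.sqrt (1 + ‖gradient g x‖ ^ 2)) ≤
      2 * (volume (Metric.ball (0 : EuclideanSpace ℝ (Fin (n - 1))) 1)).toReal *
        ε ^ ((n : ℝ) - 3) *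
        (Real.log (δ₂ * ω + Real.sqrt (1 + δ₂ ^ 2 * ω ^ 2)) / ω) := by
  obtain ⟨m, rfl⟩ : ∃ m, n = m + 1 := ⟨n - 1, by omega⟩
  exact aux_main m (by omega) ε δ₁ δ₂ ω hε hδ₂ hω F hFper hF1 hF2 pr hpr B hB g h hg hh
end

section
/- Fix n ≥ 2. For ε > 0 set δ₁ = ε³, δ₂ = ε^{3/2}, ω = ε^{−3}, ρ = ε, δ = δ₁ + δ₂, q = (δ, 0, …, 0) ∈ ℝⁿ, and let π(x) = (x₂, …, xₙ), A = {x : x₁ ≥ δ, ‖x − q‖ ≤ ε}, B = {x : δ₁ ≤ x₁ ≤ δ, ‖πx‖ ≤ ε}, C = {x : 0 ≤ x₁ ≤ δ₁, ‖πx‖ ≤ ε}, Ω = A ∪ B ∪ C. Let F : ℝ → ℝ be the 4-periodic function with F(t) = 1 − t on [0,2] and F(t) = t − 3 on [2,4], let η(t) = max{0, 1 − t}, and let γ(t) = max{0, t − δ₁}. Define f : {x ∈ ℝⁿ : x₁ ≥ 0} → ℝ by f(x) = η(d(x, Ω)/ρ) γ(x₁) F(ω‖πx‖) if x₁ ≤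 δ and f(x) = η(d(x, Ω)/ρ) δ₂ F(ω‖x − q‖) if x₁ ≥ δ, and define u supported on Ω by u(x) = 1 − ‖πx‖/ε for x ∈ B ∪ C and u(x) = 1 − ‖x − q‖/ε for x ∈ A. Then there exist constants K > 0 and ε₀ > 0, depending only on n, such that for all 0 < ε < ε₀: [∫_Ω (‖∇u‖² + ‖∇u‖²‖∇f‖² − ⟨∇u, ∇f⟩²)/√(1 + ‖∇f‖²) dx] / [∫_{{y ∈ ℝ^{n−1} : ‖y‖ ≤ ε}} (1 − ‖y‖/ε)² dy] ≤ K ε^{1/2}. -/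
open MeasureTheory RealInnerProductSpace

lemma F_deriv (F : ℝ → ℝ) (hFper : ∀ t, F (t + 4) = F t)
    (hF1 : ∀ t ∈ Set.Icc (0 : ℝ) 2, F t = 1 - t)
    (hF2 : ∀ t ∈ Set.Icc (2 : ℝ) 4, F t = t - 3) (t : ℝ) (ht : ∀ k : ℤ, t ≠ 2 * k) :
    F t ^ 2 ≤ 1 ∧ ∃ s : ℝ, s ^ 2 = 1 ∧ HasDerivAt F s t := by
  have hp : Function.Periodic F 4 := hFper
  set k : ℤ := ⌊t / 4⌋ with hk
  have h1 : (k : ℝ) ≤ t / 4 := Int.floor_le _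
  have h2 : t / 4 < k + 1 := Int.lt_floor_add_one _
  have hF : ∀ x, F x = F (x - k * 4) := fun x => (hp.sub_int_mul_eq k).symm
  have h3 := ht (2 * k)
  have h4 := ht (2 * k + 1)
  push_cast at h3 h4
  have h5 : 4 * k < t := lt_of_le_of_ne (by linarith) (by intro h; apply h3; linarith)
  rcases lt_or_gt_of_ne h4 with h | h
  · have hloc : ∀ x ∈ Set.Ioo (4 * k : ℝ) (4 * k + 2), F x = 1 - (x - k * 4) := by
      intro x hx
      rw [hF x]; apply hF1; constructor <;> linarith [hx.1, hx.2]
    have hm : t ∈ Set.Ioo (4 * k : ℝ) (4 * k + 2) := ⟨h5, by linarith⟩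
    refine ⟨?_, -1, by norm_num, ?_⟩
    · rw [hloc t hm]; nlinarith [hm.1, hm.2]
    · have : HasDerivAt (fun x : ℝ => 1 - (x - k * 4)) (-1) t := by
        simpa using ((hasDerivAt_id t).sub_const (k * 4 : ℝ)).const_sub 1
      exact this.congr_of_eventuallyEq
        (Filter.eventuallyEq_of_mem (isOpen_Ioo.mem_nhds hm) hloc)
  · have hloc : ∀ x ∈ Set.Ioo (4 * k + 2 : ℝ) (4 * k + 4), F x = (x - k * 4) - 3 := by
      intro x hx
      rw [hF x]; apply hF2; constructor <;> linarith [hx.1, hx.2]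
    have hm : t ∈ Set.Ioo (4 * k + 2 : ℝ) (4 * k + 4) := ⟨by linarith, by linarith⟩
    refine ⟨?_, 1, by norm_num, ?_⟩
    · rw [hloc t hm]; nlinarith [hm.1, hm.2]
    · have : HasDerivAt (fun x : ℝ => (x - k * 4) - 3) (1) t := by
        simpa using ((hasDerivAt_id t).sub_const (k * 4 : ℝ)).sub_const 3
      exact this.congr_of_eventuallyEq
        (Filter.eventuallyEq_of_mem (isOpen_Ioo.mem_nhds hm) hloc)

lemma pointwise {V : Type*} [NormedAddCommGroup V] [InnerProductSpace ℝ V]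
    (gu gf w e : V) (c a b : ℝ) (hw : ‖w‖ = 1) (he : ‖e‖ = 1)
    (h : a = 0 ∨ ⟪w, e⟫ = 0) (hu : gu = c • w) (hf : gf = a • e + b • w) :
    (‖gu‖ ^ 2 + ‖gu‖ ^ 2 * ‖gf‖ ^ 2 - ⟪gu, gf⟫ ^ 2) / Real.sqrt (1 + ‖gf‖ ^ 2)
      = c ^ 2 * (1 + a ^ 2) / Real.sqrt (1 + (a ^ 2 + b ^ 2)) := by
  have h0 : a * ⟪w, e⟫ = 0 := by rcases h with h | h <;> simp [h]
  have h1 : ‖gu‖ ^ 2 = c ^ 2 := by rw [hu, norm_smul, hw]; simp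
  have hww : ⟪w, w⟫ = 1 := by rw [real_inner_self_eq_norm_sq, hw]; simp
  have hee : ⟪e, e⟫ = 1 := by rw [real_inner_self_eq_norm_sq, he]; simp
  have h2 : ‖gf‖ ^ 2 = a ^ 2 + b ^ 2 := by
    rw [← real_inner_self_eq_norm_sq, hf]
    simp only [inner_add_left, inner_add_right, inner_smul_left, inner_smul_right, hww, hee,
      conj_trivial]
    have hc := real_inner_comm w e
    linear_combination (2 * b) * h0 + a * b * hc
  have h3 : ⟪gu, gf⟫ = c * b := by
    rw [hu, hf]
    simp only [inner_add_right, inner_smul_left, inner_smul_right, hww, conj_trivial]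
    linear_combination c * h0
  rw [h1, h2, h3]
  congr 1
  ring

lemma num_nonneg {V : Type*} [NormedAddCommGroup V] [InnerProductSpace ℝ V] (gu gf : V) :
    0 ≤ (‖gu‖ ^ 2 + ‖gu‖ ^ 2 * ‖gf‖ ^ 2 - ⟪gu, gf⟫ ^ 2) / Real.sqrt (1 + ‖gf‖ ^ 2) := by
  apply div_nonneg _ (Real.sqrt_nonneg _)
  have := abs_real_inner_le_norm gu gf
  have h2 : ⟪gu, gf⟫ ^ 2 ≤ (‖gu‖ * ‖gf‖) ^ 2 := sq_le_sq' (by linarith [neg_abs_le (⟪gu, gf⟫)]) (le_trans (le_abs_self _) this)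
  nlinarith [sq_nonneg ‖gu‖]

/-- radial direction -/
lemma grad_norm_sub {V : Type*} [NormedAddCommGroup V] [InnerProductSpace ℝ V] [CompleteSpace V]
    (q x : V) (h : ‖x - q‖ ≠ 0) : HasGradientAt (fun y => ‖y - q‖) (‖x - q‖⁻¹ • (x - q)) x := by
  have h0 : x - q ≠ 0 := by simpa using h
  have h1 : HasFDerivAt (fun y => y - q) (ContinuousLinearMap.id ℝ V) x :=
    (hasFDerivAt_id x).sub_const q
  have h2 := (h1.norm_sq).sqrt (by positivity)
  rw [hasGradientAt_iff_hasFDerivAt]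
  have : (fun y => √(‖y - q‖ ^ 2)) = fun y => ‖y - q‖ := by
    ext y; exact Real.sqrt_sq (norm_nonneg _)
  rw [this] at h2
  refine h2.congr_fderiv ?_
  ext v
  simp [Real.sqrt_sq (norm_nonneg _)]
  field_simp

noncomputable def emb {m : ℕ} (y : EuclideanSpace ℝ (Fin m)) : EuclideanSpace ℝ (Fin (m+1)) :=
  WithLp.toLp 2 (Fin.cons 0 (fun i => y i))

lemma grad_norm_pr {m : ℕ} (pr : EuclideanSpace ℝ (Fin (m+1)) → EuclideanSpace ℝ (Fin m))
    (hpr : ∀ x i, pr x i = x i.succ) (x : EuclideanSpace ℝ (Fin (m+1))) (h : ‖pr x‖ ≠ 0) :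
    HasGradientAt (fun y => ‖pr y‖) (‖pr x‖⁻¹ • emb (pr x)) x := by
  let L : EuclideanSpace ℝ (Fin (m+1)) →L[ℝ] EuclideanSpace ℝ (Fin m) :=
    LinearMap.toContinuousLinearMap
    { toFun := pr
      map_add' := by intro a b; ext i; simp [hpr]
      map_smul' := by intro a b; ext i; simp [hpr] }
  have hL : ∀ x, L x = pr x := fun x => rfl
  have h0 : pr x ≠ 0 := by simpa using h
  have h1 : HasFDerivAt pr L x := L.hasFDerivAt
  have h2 := (h1.norm_sq).sqrt (by positivity)
  rw [hasGradientAt_iff_hasFDerivAt]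
  have : (fun y => √(‖pr y‖ ^ 2)) = fun y => ‖pr y‖ := by
    ext y; exact Real.sqrt_sq (norm_nonneg _)
  rw [this] at h2
  refine h2.congr_fderiv ?_
  ext v
  simp [Real.sqrt_sq (norm_nonneg _), hL]
  have : ⟪emb (pr x), v⟫ = ⟪pr x, pr v⟫ := by
    simp [PiLp.inner_apply, Fin.sum_univ_succ, emb, hpr]
  rw [this]
  field_simp

lemma norm_emb {m : ℕ} (y : EuclideanSpace ℝ (Fin m)) : ‖emb y‖ = ‖y‖ := by
  simp [EuclideanSpace.norm_eq, emb, Fin.sum_univ_succ]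

lemma emb_inner {m : ℕ} (y : EuclideanSpace ℝ (Fin m)) :
    ⟪emb y, EuclideanSpace.single (0 : Fin (m+1)) (1:ℝ)⟫ = 0 := by
  simp [emb, EuclideanSpace.inner_single_right]

noncomputable def spl (m : ℕ) : EuclideanSpace ℝ (Fin (m+1)) ≃ᵐ ℝ × EuclideanSpace ℝ (Fin m) :=
  ((MeasurableEquiv.toLp 2 (Fin (m+1) → ℝ)).symm.trans
    (MeasurableEquiv.piFinSuccAbove (fun _ => ℝ) 0)).trans
    ((MeasurableEquiv.refl ℝ).prodCongr (MeasurableEquiv.toLp 2 (Fin m → ℝ)))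

lemma spl_mp (m : ℕ) : MeasurePreserving (spl m) volume (volume.prod volume) := by
  have h1 := PiLp.volume_preserving_ofLp (Fin (m+1))
  have h2 := volume_preserving_piFinSuccAbove (fun _ : Fin (m+1) => ℝ) 0
  have h3 := PiLp.volume_preserving_toLp (Fin m)
  exact ((MeasurePreserving.id (volume : Measure ℝ)).prod h3).comp (h2.comp h1)

lemma spl_fst {m : ℕ} (x) : (spl m x).1 = x 0 := rfl
lemma spl_snd {m : ℕ} (x) (i) : (spl m x).2 i = x i.succ := rfl

lemma grad_mul_comp {V : Type*} [NormedAddCommGroup V] [InnerProductSpace ℝ V] [CompleteSpace V]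
    (g r : V → ℝ) (F : ℝ → ℝ) (e w x : V) (ω s : ℝ) (hg : HasGradientAt g e x)
    (hr : HasGradientAt r w x) (hF : HasDerivAt F s (ω * r x)) :
    HasGradientAt (fun y => g y * F (ω * r y)) (F (ω * r x) • e + (g x * (ω * s)) • w) x := by
  rw [hasGradientAt_iff_hasFDerivAt] at *
  have h1 := hF.comp_hasFDerivAt x (hr.const_mul ω)
  refine (hg.mul h1).congr_fderiv ?_
  ext v
  simp
  ring

lemma grad_coord {m : ℕ} (c : ℝ) (x : EuclideanSpace ℝ (Fin (m+1))) :
    HasGradientAt (fun y : EuclideanSpace ℝ (Fin (m+1)) => y 0 - c)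
      (EuclideanSpace.single (0 : Fin (m+1)) (1:ℝ)) x := by
  rw [hasGradientAt_iff_hasFDerivAt]
  have := ((EuclideanSpace.proj (0 : Fin (m+1)) : EuclideanSpace ℝ (Fin (m+1)) →L[ℝ] ℝ).hasFDerivAt (x := x)).sub_const c
  refine this.congr_fderiv ?_
  ext v
  simp [EuclideanSpace.inner_single_left]

lemma grad_u {V : Type*} [NormedAddCommGroup V] [InnerProductSpace ℝ V] [CompleteSpace V]
    (r : V → ℝ) (w x : V) (ε : ℝ) (hr : HasGradientAt r w x) :
    HasGradientAt (fun y => 1 - r y / ε) ((-ε⁻¹) • w) x := by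
  rw [hasGradientAt_iff_hasFDerivAt] at *
  have := (hr.const_mul ε⁻¹).const_sub 1
  have h : (fun y => 1 - r y / ε) = fun y => 1 - ε⁻¹ * r y := by
    ext y; rw [div_eq_inv_mul]
  rw [h]
  refine this.congr_fderiv ?_
  ext v
  simp

lemma ae_norm_ne (m : ℕ) (hm : 1 ≤ m) (q : EuclideanSpace ℝ (Fin m)) (c : ℝ) :
    ∀ᵐ x : EuclideanSpace ℝ (Fin m), ‖x - q‖ ≠ c := by
  have : Nonempty (Fin m) := ⟨⟨0, hm⟩⟩
  have := Measure.addHaar_sphere (volume : Measure (EuclideanSpace ℝ (Fin m))) q c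
  rw [measure_eq_zero_iff_ae_notMem] at this
  filter_upwards [this] with x hx
  simpa [dist_eq_norm] using hx

lemma ae_pr_ne (m : ℕ) (hm : 1 ≤ m) (c : ℝ) :
    ∀ᵐ x : EuclideanSpace ℝ (Fin (m+1)), ‖(spl m x).2‖ ≠ c := by
  have h1 : Measure.QuasiMeasurePreserving (fun x => (spl m x).2) volume volume :=
    Measure.quasiMeasurePreserving_snd.comp (spl_mp m).quasiMeasurePreserving
  have := h1.ae (ae_norm_ne m hm 0 c)
  simpa using this

lemma ae_coord_ne (m : ℕ) (c : ℝ) :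
    ∀ᵐ x : EuclideanSpace ℝ (Fin (m+1)), x 0 ≠ c := by
  have h1 : Measure.QuasiMeasurePreserving (fun x => (spl m x).1) volume volume :=
    Measure.quasiMeasurePreserving_fst.comp (spl_mp m).quasiMeasurePreserving
  exact h1.ae (Measure.ae_ne volume c)

lemma int_ball (m : ℕ) (q : EuclideanSpace ℝ (Fin m)) (ε : ℝ) (hε : 0 < ε) :
    volume.real (Metric.closedBall q ε) = ε ^ m * volume.real (Metric.closedBall (0 : EuclideanSpace ℝ (Fin m)) 1) := by
  rw [Measure.real, Measure.addHaar_closedBall' _ _ hε.le]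
  simp [Measure.real, ENNReal.toReal_mul, hε.le]

lemma denom (m : ℕ) (ε : ℝ) (hε : 0 < ε) :
    (1/4) * ((ε/2) ^ m * volume.real (Metric.closedBall (0 : EuclideanSpace ℝ (Fin m)) 1)) ≤
    ∫ y in {y : EuclideanSpace ℝ (Fin m) | ‖y‖ ≤ ε}, (1 - ‖y‖ / ε) ^ 2 := by
  have hs : {y : EuclideanSpace ℝ (Fin m) | ‖y‖ ≤ ε} = Metric.closedBall 0 ε := by
    ext; simp
  rw [hs, ← int_ball m 0 _ (by positivity : 0 < ε/2)]
  have hi : ∀ r, IntegrableOn (fun y : EuclideanSpace ℝ (Fin m) => (1 - ‖y‖ / ε) ^ 2) (Metric.closedBall 0 r) := fun r =>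
    (Continuous.continuousOn (by fun_prop)).integrableOn_compact (isCompact_closedBall _ _)
  calc _ = ∫ y in Metric.closedBall (0 : EuclideanSpace ℝ (Fin m)) (ε/2), (1/4 : ℝ) := by
        simp [mul_comm]
    _ ≤ ∫ y in Metric.closedBall (0 : EuclideanSpace ℝ (Fin m)) (ε/2), (1 - ‖y‖ / ε) ^ 2 := by
        apply setIntegral_mono_on _ (hi _) measurableSet_closedBall
        · intro y hy
          have hy : ‖y‖ ≤ ε / 2 := by simpa using hy
          have : ‖y‖ / ε ≤ 1 / 2 := by rw [div_le_iff₀ hε]; linarith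
          nlinarith
        · simp [integrableOn_const_iff, measure_closedBall_lt_top]
    _ ≤ _ := by
        apply setIntegral_mono_set (hi _)
        · exact Filter.Eventually.of_forall fun y => sq_nonneg _
        · exact (Metric.closedBall_subset_closedBall (by linarith)).eventuallyLE

/-- one-dimensional profile -/
noncomputable def phi (s : ℝ) : ℝ → ℝ := 
  (Set.Ioc 0 (s^6)).indicator (fun _ => (s^4)⁻¹) +
  (Set.Ioc (s^6) (s^6 + s^3)).indicator (fun t => 2 * (t - s^6) ^ (-(2/3) : ℝ))

lemma phi_int (s : ℝ) (hs : 0 < s) : Integrable (phi s) ∧ ∫ t, phi s t = s^2 + 6 * s := by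
  have h1 : IntervalIntegrable (fun t : ℝ => t ^ (-(2/3) : ℝ)) volume 0 (s^3) :=
    intervalIntegral.intervalIntegrable_rpow' (by norm_num)
  have h2 : IntervalIntegrable (fun t : ℝ => 2 * (t - s^6) ^ (-(2/3) : ℝ)) volume (s^6) (s^6+s^3) := by
    have := (h1.comp_sub_right (s^6)).const_mul 2
    simpa [add_comm] using this
  have hle : s^6 ≤ s^6+s^3 := by have := pow_pos hs 3; linarith
  have i1 : Integrable ((Set.Ioc 0 (s^6)).indicator (fun _ : ℝ => (s^4)⁻¹)) := by
    rw [integrable_indicator_iff measurableSet_Ioc]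
    simp [integrableOn_const_iff]
  have i2 : Integrable ((Set.Ioc (s^6) (s^6 + s^3)).indicator (fun t : ℝ => 2 * (t - s^6) ^ (-(2/3) : ℝ))) := by
    rw [integrable_indicator_iff measurableSet_Ioc]
    exact (intervalIntegrable_iff_integrableOn_Ioc_of_le hle).1 h2
  refine ⟨i1.add i2, ?_⟩
  unfold phi
  rw [integral_add' i1 i2, integral_indicator measurableSet_Ioc, integral_indicator measurableSet_Ioc,
    ← intervalIntegral.integral_of_le hle]
  have h3 : ∫ t in (s^6)..(s^6+s^3), 2 * (t - s^6) ^ (-(2/3) : ℝ) = 6 * s := by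
    rw [intervalIntegral.integral_const_mul, intervalIntegral.integral_comp_sub_right (fun t => t ^ (-(2/3) : ℝ))]
    rw [sub_self, add_sub_cancel_left, integral_rpow (by left; norm_num)]
    have : (s^3) ^ ((-(2/3) : ℝ) + 1) = s := by
      rw [← Real.rpow_natCast, ← Real.rpow_mul hs.le]; norm_num
    rw [this, Real.zero_rpow (by norm_num)]
    ring
  rw [h3]
  simp
  rw [max_eq_left (by positivity)]
  field_simp

lemma G_int (m : ℕ) (q : EuclideanSpace ℝ (Fin (m+1))) (s : ℝ) (hs : 0 < s) :
    let G : EuclideanSpace ℝ (Fin (m+1)) → ℝ := (Metric.closedBall q (s^2)).indicator (fun _ => s⁻¹) +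
      fun x => phi s (spl m x).1 * (Metric.closedBall (0 : EuclideanSpace ℝ (Fin m)) (s^2)).indicator (fun _ => (1:ℝ)) (spl m x).2
    Integrable G ∧ ∫ x, G x = 
      s⁻¹ * ((s^2)^(m+1) * volume.real (Metric.closedBall (0 : EuclideanSpace ℝ (Fin (m+1))) 1))
      + (s^2+6*s) * ((s^2)^m * volume.real (Metric.closedBall (0 : EuclideanSpace ℝ (Fin m)) 1)) := by
  intro G
  have i1 : Integrable ((Metric.closedBall q (s^2)).indicator (fun _ => s⁻¹)) := by
    rw [integrable_indicator_iff measurableSet_closedBall]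
    simp [integrableOn_const_iff, measure_closedBall_lt_top]
  have i2 : Integrable ((Metric.closedBall (0 : EuclideanSpace ℝ (Fin m)) (s^2)).indicator (fun _ => (1:ℝ))) := by
    rw [integrable_indicator_iff measurableSet_closedBall]
    simp [integrableOn_const_iff, measure_closedBall_lt_top]
  have i3 := ((phi_int s hs).1).mul_prod i2
  have i4 := (spl_mp m).integrable_comp_of_integrable i3
  refine ⟨i1.add i4, ?_⟩
  have e := (spl_mp m).integral_comp' (fun z : ℝ × EuclideanSpace ℝ (Fin m) => phi s z.1 * (Metric.closedBall (0 : EuclideanSpace ℝ (Fin m)) (s^2)).indicator (fun _ => (1:ℝ)) z.2)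
  have := integral_add' i1 i4
  refine this.trans ?_
  rw [← int_ball _ q _ (by positivity), ← int_ball m 0 _ (by positivity)]
  congr 1
  · rw [integral_indicator measurableSet_closedBall]; simp [mul_comm]
  · refine e.trans ?_
    rw [integral_prod_mul, (phi_int s hs).2, integral_indicator measurableSet_closedBall]
    simp

lemma phi_nonneg (s : ℝ) (hs : 0 < s) (t : ℝ) : 0 ≤ phi s t := by
  unfold phi
  apply add_nonneg
  · apply Set.indicator_nonneg; intro _ _; positivity
  · apply Set.indicator_nonneg; intro t ht
    have : 0 < t - s^6 := by linarith [ht.1]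
    positivity

noncomputable def GG (m : ℕ) (q : EuclideanSpace ℝ (Fin (m+1))) (s : ℝ) :
    EuclideanSpace ℝ (Fin (m+1)) → ℝ := (Metric.closedBall q (s^2)).indicator (fun _ => s⁻¹) +
      fun x => phi s (spl m x).1 * (Metric.closedBall (0 : EuclideanSpace ℝ (Fin m)) (s^2)).indicator (fun _ => (1:ℝ)) (spl m x).2

lemma GG_nonneg (m : ℕ) (q : EuclideanSpace ℝ (Fin (m+1))) (s : ℝ) (hs : 0 < s) (x) :
    0 ≤ GG m q s x := by
  unfold GG
  apply add_nonneg
  · apply Set.indicator_nonneg; intro _ _; positivity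
  · apply mul_nonneg (phi_nonneg s hs _)
    apply Set.indicator_nonneg; intro _ _; positivity

lemma GG_A (m : ℕ) (q : EuclideanSpace ℝ (Fin (m+1))) (s : ℝ) (hs : 0 < s) (x)
    (hx : ‖x - q‖ ≤ s^2) : s⁻¹ ≤ GG m q s x := by
  unfold GG
  have h1 : x ∈ Metric.closedBall q (s^2) := by simpa [dist_eq_norm] using hx
  rw [Pi.add_apply, Set.indicator_of_mem h1]
  apply le_add_of_nonneg_right
  apply mul_nonneg (phi_nonneg s hs _)
  apply Set.indicator_nonneg; intro _ _; positivity

lemma GG_BC (m : ℕ) (q : EuclideanSpace ℝ (Fin (m+1))) (s : ℝ) (hs : 0 < s) (x)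
    (hx : ‖(spl m x).2‖ ≤ s^2) : phi s (x 0) ≤ GG m q s x := by
  unfold GG
  have h1 : (spl m x).2 ∈ Metric.closedBall (0 : EuclideanSpace ℝ (Fin m)) (s^2) := by simpa using hx
  rw [Pi.add_apply, Set.indicator_of_mem h1, mul_one, spl_fst]
  apply le_add_of_nonneg_left
  apply Set.indicator_nonneg; intro _ _; positivity

lemma bound_B (s t a b : ℝ) (hs : 0 < s) (ht : 0 < t) (ha : a ^ 2 ≤ 1)
    (hb : b ^ 2 = (t * (s^6)⁻¹) ^ 2) :
    ((-(s^2)⁻¹) ^ 2 * (1 + a ^ 2)) / Real.sqrt (1 + (a ^ 2 + b ^ 2)) ≤ 2 * t ^ (-(2/3) : ℝ) := by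
  set z := t * (s^6)⁻¹ with hz
  have hz0 : 0 < z := by positivity
  have h1 : z ^ (2/3 : ℝ) ≤ Real.sqrt (1 + (a ^ 2 + b ^ 2)) := by
    rcases le_total z 1 with h | h
    · apply (Real.rpow_le_one hz0.le h (by norm_num)).trans
      rw [Real.one_le_sqrt]; nlinarith [sq_nonneg a, sq_nonneg b]
    · calc z ^ (2/3 : ℝ) ≤ z ^ (1:ℝ) := Real.rpow_le_rpow_of_exponent_le h (by norm_num)
        _ = z := Real.rpow_one z
        _ ≤ _ := by apply Real.le_sqrt_of_sq_le; nlinarith [sq_nonneg a]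
  have h2 : z ^ (2/3 : ℝ) = t ^ (2/3 : ℝ) * (s^4)⁻¹ := by
    rw [hz, Real.mul_rpow ht.le (by positivity), Real.inv_rpow (by positivity)]
    congr 2
    rw [← Real.rpow_natCast, ← Real.rpow_mul hs.le, ← Real.rpow_natCast]; norm_num
  have h3 : 0 < z ^ (2/3 : ℝ) := by positivity
  have h4 : 0 < t ^ (2/3 : ℝ) := by positivity
  rw [div_le_iff₀ (lt_of_lt_of_le h3 h1), Real.rpow_neg ht.le]
  calc (-(s^2)⁻¹) ^ 2 * (1 + a ^ 2) ≤ (-(s^2)⁻¹) ^ 2 * 2 := by gcongr; linarith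
    _ = 2 * (t ^ (2/3 : ℝ))⁻¹ * z ^ (2/3 : ℝ) := by rw [h2]; field_simp
    _ ≤ _ := by gcongr

lemma bound_A (s b : ℝ) (hs : 0 < s) 
    (hb : b ^ 2 = (s^3 * (s^6)⁻¹) ^ 2) :
    ((-(s^2)⁻¹) ^ 2 * (1 + 0 ^ 2)) / Real.sqrt (1 + (0 ^ 2 + b ^ 2)) ≤ s⁻¹ := by
  have h1 : s^3 * (s^6)⁻¹ ≤ Real.sqrt (1 + (0 ^ 2 + b ^ 2)) := by
    apply Real.le_sqrt_of_sq_le; linarith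
  rw [div_le_iff₀ (by positivity)]
  calc _ = s⁻¹ * (s^3 * (s^6)⁻¹) := by field_simp; norm_num
    _ ≤ _ := by gcongr

lemma key (m : ℕ) 
    (F : ℝ → ℝ) (hFper : ∀ t, F (t + 4) = F t)
    (hF1 : ∀ t ∈ Set.Icc (0 : ℝ) 2, F t = 1 - t)
    (hF2 : ∀ t ∈ Set.Icc (2 : ℝ) 4, F t = t - 3) (s : ℝ) (hs : 0 < s)
    (q : EuclideanSpace ℝ (Fin (m+1)))
    (pr : EuclideanSpace ℝ (Fin (m+1)) → EuclideanSpace ℝ (Fin m))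
    (A B C Ω : Set (EuclideanSpace ℝ (Fin (m+1))))
    (f u : EuclideanSpace ℝ (Fin (m+1)) → ℝ)
    (hpr : pr = fun x => (spl m x).2)
    (hA : A = {x | s^6 + s^3 ≤ x 0 ∧ ‖x - q‖ ≤ s^2})
    (hB : B = {x | s^6 ≤ x 0 ∧ x 0 ≤ s^6 + s^3 ∧ ‖pr x‖ ≤ s^2})
    (hC : C = {x | 0 ≤ x 0 ∧ x 0 ≤ s^6 ∧ ‖pr x‖ ≤ s^2})
    (hΩ : Ω = A ∪ B ∪ C)
    (hf1 : ∀ x : EuclideanSpace ℝ (Fin (m+1)), 0 ≤ x 0 → x 0 ≤ s^6 + s^3 →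
          f x = max 0 (1 - Metric.infDist x Ω / s^2) *
            (max 0 (x 0 - s^6) * F ((s^6)⁻¹ * ‖pr x‖)))
    (hf2 : ∀ x : EuclideanSpace ℝ (Fin (m+1)), s^6 + s^3 ≤ x 0 →
          f x = max 0 (1 - Metric.infDist x Ω / s^2) *
            (s^3 * F ((s^6)⁻¹ * ‖x - q‖)))
    (hu1 : ∀ x ∈ A, u x = 1 - ‖x - q‖ / s^2)
    (hu2 : ∀ x ∈ B ∪ C, u x = 1 - ‖pr x‖ / s^2)
    (x : EuclideanSpace ℝ (Fin (m+1))) (hx : x ∈ Ω)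
    (n1 : x 0 ≠ 0) (n2 : x 0 ≠ s^6) (n3 : x 0 ≠ s^6 + s^3) (n4 : ‖pr x‖ ≠ s^2)
    (n5 : ‖x - q‖ ≠ s^2) (n6 : ∀ k : ℤ, ‖pr x‖ ≠ s^6 * (2 * k))
    (n7 : ∀ k : ℤ, ‖x - q‖ ≠ s^6 * (2 * k)) :
    (‖gradient u x‖ ^ 2 + ‖gradient u x‖ ^ 2 * ‖gradient f x‖ ^ 2 -
              ⟪gradient u x, gradient f x⟫ ^ 2) /
              Real.sqrt (1 + ‖gradient f x‖ ^ 2) ≤ GG m q s x := by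
  have hpr' : ∀ x i, pr x i = x i.succ := by intro x i; rw [hpr]; rfl
  have s6 : 0 < s^6 := by positivity
  have s3 : 0 < s^3 := by positivity
  have p0 : ‖pr x‖ ≠ 0 := by simpa using n6 0
  have q0 : ‖x - q‖ ≠ 0 := by simpa using n7 0
  have c0 : Continuous (fun y : EuclideanSpace ℝ (Fin (m+1)) => y 0) := by fun_prop
  have cp : Continuous pr := by
    have : pr = fun y => WithLp.toLp 2 (fun i : Fin m => y i.succ) := by
      funext y; ext i; simp [hpr']
    rw [this]; fun_prop
  have cn : Continuous (fun y => ‖pr y‖) := cp.norm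
  have cq : Continuous (fun y => ‖y - q‖) := by fun_prop
  have heta : ∀ y ∈ Ω, max 0 (1 - Metric.infDist y Ω / s^2) = 1 := by
    intro y hy; rw [Metric.infDist_zero_of_mem hy]; simp
  have n6' : ∀ k : ℤ, (s^6)⁻¹ * ‖pr x‖ ≠ 2 * k := by
    intro k h; apply n6 k; rw [← h]; field_simp
  have n7' : ∀ k : ℤ, (s^6)⁻¹ * ‖x - q‖ ≠ 2 * k := by
    intro k h; apply n7 k; rw [← h]; field_simp
  have e1 : ‖EuclideanSpace.single (0 : Fin (m+1)) (1:ℝ)‖ = 1 := by simp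
  have w1 : ‖‖pr x‖⁻¹ • emb (pr x)‖ = 1 := by
    rw [norm_smul, norm_emb]; simp; field_simp
  have w2 : ‖‖x - q‖⁻¹ • (x - q)‖ = 1 := by
    rw [norm_smul]; simp; field_simp
  have we : ⟪‖pr x‖⁻¹ • emb (pr x), EuclideanSpace.single (0 : Fin (m+1)) (1:ℝ)⟫ = 0 := by
    rw [inner_smul_left, emb_inner, mul_zero]
  have gp := grad_norm_pr pr hpr' x p0
  have gq := grad_norm_sub q x q0
  rw [hΩ] at hx
  rcases hx with (hx | hx) | hx
  · -- region A
    rw [hA] at hx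
    let U := {y : EuclideanSpace ℝ (Fin (m+1)) | s^6 + s^3 < y 0 ∧ ‖y - q‖ < s^2}
    have hU : IsOpen U := (isOpen_lt continuous_const c0).inter (isOpen_lt cq continuous_const)
    have hxU : x ∈ U := ⟨lt_of_le_of_ne hx.1 n3.symm, lt_of_le_of_ne hx.2 n5⟩
    have hUA : ∀ y ∈ U, y ∈ A := by intro y hy; rw [hA]; exact ⟨hy.1.le, hy.2.le⟩
    have eu : ∀ y ∈ U, u y = 1 - ‖y - q‖ / s^2 := fun y hy => hu1 y (hUA y hy)
    have ef : ∀ y ∈ U, f y = s^3 * F ((s^6)⁻¹ * ‖y - q‖) := fun y hy => by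
      rw [hf2 y hy.1.le, heta y (by rw [hΩ]; exact Or.inl (Or.inl (hUA y hy))), one_mul]
    obtain ⟨-, σ, hσ, hd⟩ := F_deriv F hFper hF1 hF2 _ n7'
    have gu := ((grad_u _ _ _ (s^2) gq).congr_of_eventuallyEq
      (Filter.eventuallyEq_of_mem (hU.mem_nhds hxU) eu)).gradient
    have gf := ((grad_mul_comp (fun _ => s^3) _ F 0 _ x (s^6)⁻¹ σ (hasGradientAt_const x (s^3)) gq hd).congr_of_eventuallyEq
      (Filter.eventuallyEq_of_mem (hU.mem_nhds hxU) ef)).gradient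
    rw [pointwise _ _ _ (EuclideanSpace.single (0 : Fin (m+1)) (1:ℝ)) (-(s^2)⁻¹) 0 (s^3 * ((s^6)⁻¹ * σ)) w2 e1 (Or.inl rfl) gu
      (by rw [gf]; simp)]
    refine (bound_A s _ hs ?_).trans (GG_A m q s hs x hx.2)
    rw [← mul_assoc, mul_pow, hσ, mul_one]
  · -- region B
    rw [hB] at hx
    let U := {y : EuclideanSpace ℝ (Fin (m+1)) | (s^6 < y 0 ∧ y 0 < s^6 + s^3) ∧ ‖pr y‖ < s^2}
    have hU : IsOpen U := ((isOpen_lt continuous_const c0).inter (isOpen_lt c0 continuous_const)).inter (isOpen_lt cn continuous_const)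
    have hxU : x ∈ U := ⟨⟨lt_of_le_of_ne hx.1 n2.symm, lt_of_le_of_ne hx.2.1 n3⟩, lt_of_le_of_ne hx.2.2 n4⟩
    have hUA : ∀ y ∈ U, y ∈ B := by intro y hy; rw [hB]; exact ⟨hy.1.1.le, hy.1.2.le, hy.2.le⟩
    have eu : ∀ y ∈ U, u y = 1 - ‖pr y‖ / s^2 := fun y hy => hu2 y (Or.inl (hUA y hy))
    have ef : ∀ y ∈ U, f y = (y 0 - s^6) * F ((s^6)⁻¹ * ‖pr y‖) := fun y hy => by
      rw [hf1 y (s6.le.trans hy.1.1.le) hy.1.2.le, heta y (by rw [hΩ]; exact Or.inl (Or.inr (hUA y hy))), one_mul,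
        max_eq_right (by linarith [hy.1.1])]
    obtain ⟨hF, σ, hσ, hd⟩ := F_deriv F hFper hF1 hF2 _ n6'
    have gu := ((grad_u _ _ _ (s^2) gp).congr_of_eventuallyEq
      (Filter.eventuallyEq_of_mem (hU.mem_nhds hxU) eu)).gradient
    have gf := ((grad_mul_comp _ _ F _ _ x (s^6)⁻¹ σ (grad_coord (s^6) x) gp hd).congr_of_eventuallyEq
      (Filter.eventuallyEq_of_mem (hU.mem_nhds hxU) ef)).gradient
    rw [pointwise _ _ _ _ _ _ _ w1 e1 (Or.inr we) gu gf]
    have hph : phi s (x 0) = 2 * (x 0 - s^6) ^ (-(2/3) : ℝ) := by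
      unfold phi
      rw [Pi.add_apply, Set.indicator_of_notMem, Set.indicator_of_mem, zero_add]
      · exact ⟨hxU.1.1, hxU.1.2.le⟩
      · intro h; exact absurd h.2 (not_le.2 hxU.1.1)
    refine le_trans ?_ (GG_BC m q s hs x (by rw [hpr] at hx; exact hx.2.2))
    rw [hph]
    apply bound_B s _ _ _ hs (by linarith [hxU.1.1]) hF
    rw [← mul_assoc, mul_pow, hσ, mul_one]
  · -- region C
    rw [hC] at hx
    let U := {y : EuclideanSpace ℝ (Fin (m+1)) | (0 < y 0 ∧ y 0 < s^6) ∧ ‖pr y‖ < s^2}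
    have hU : IsOpen U := ((isOpen_lt continuous_const c0).inter (isOpen_lt c0 continuous_const)).inter (isOpen_lt cn continuous_const)
    have hxU : x ∈ U := ⟨⟨lt_of_le_of_ne hx.1 n1.symm, lt_of_le_of_ne hx.2.1 n2⟩, lt_of_le_of_ne hx.2.2 n4⟩
    have hUA : ∀ y ∈ U, y ∈ C := by intro y hy; rw [hC]; exact ⟨hy.1.1.le, hy.1.2.le, hy.2.le⟩
    have eu : ∀ y ∈ U, u y = 1 - ‖pr y‖ / s^2 := fun y hy => hu2 y (Or.inr (hUA y hy))
    have ef : ∀ y ∈ U, f y = 0 := fun y hy => by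
      rw [hf1 y hy.1.1.le (by linarith [hy.1.2]), max_eq_left (by linarith [hy.1.2] : y 0 - s^6 ≤ 0)]
      simp
    have gu := ((grad_u _ _ _ (s^2) gp).congr_of_eventuallyEq
      (Filter.eventuallyEq_of_mem (hU.mem_nhds hxU) eu)).gradient
    have gf := ((hasGradientAt_const x (0:ℝ)).congr_of_eventuallyEq
      (Filter.eventuallyEq_of_mem (hU.mem_nhds hxU) ef)).gradient
    rw [pointwise _ _ _ _ _ 0 0 w1 e1 (Or.inr we) gu (by rw [gf]; simp)]
    have hph : phi s (x 0) = (s^4)⁻¹ := by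
      unfold phi
      rw [Pi.add_apply, Set.indicator_of_mem, Set.indicator_of_notMem, add_zero]
      · intro h; exact absurd h.1 (not_lt.2 hxU.1.2.le)
      · exact ⟨hxU.1.1, hxU.1.2.le⟩
    refine le_trans ?_ (GG_BC m q s hs x (by rw [hpr] at hx; exact hx.2.2))
    rw [hph]
    simp
    rw [← pow_mul]

lemma main_aux (m : ℕ) (hm : 1 ≤ m)
    (F : ℝ → ℝ) (hFper : ∀ t, F (t + 4) = F t)
    (hF1 : ∀ t ∈ Set.Icc (0 : ℝ) 2, F t = 1 - t)
    (hF2 : ∀ t ∈ Set.Icc (2 : ℝ) 4, F t = t - 3) :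
    ∃ K > (0 : ℝ), ∀ s : ℝ, 0 < s → s < 1 →
      ∀ (q : EuclideanSpace ℝ (Fin (m+1)))
        (pr : EuclideanSpace ℝ (Fin (m+1)) → EuclideanSpace ℝ (Fin m))
        (A B C Ω : Set (EuclideanSpace ℝ (Fin (m+1))))
        (f u : EuclideanSpace ℝ (Fin (m+1)) → ℝ)
    (_ : pr = fun x => (spl m x).2)
    (_ : A = {x | s^6 + s^3 ≤ x 0 ∧ ‖x - q‖ ≤ s^2})
    (_ : B = {x | s^6 ≤ x 0 ∧ x 0 ≤ s^6 + s^3 ∧ ‖pr x‖ ≤ s^2})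
    (_ : C = {x | 0 ≤ x 0 ∧ x 0 ≤ s^6 ∧ ‖pr x‖ ≤ s^2})
    (_ : Ω = A ∪ B ∪ C)
    (_ : ∀ x : EuclideanSpace ℝ (Fin (m+1)), 0 ≤ x 0 → x 0 ≤ s^6 + s^3 →
          f x = max 0 (1 - Metric.infDist x Ω / s^2) *
            (max 0 (x 0 - s^6) * F ((s^6)⁻¹ * ‖pr x‖)))
    (_ : ∀ x : EuclideanSpace ℝ (Fin (m+1)), s^6 + s^3 ≤ x 0 →
          f x = max 0 (1 - Metric.infDist x Ω / s^2) *
            (s^3 * F ((s^6)⁻¹ * ‖x - q‖)))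
    (_ : ∀ x ∈ A, u x = 1 - ‖x - q‖ / s^2)
    (_ : ∀ x ∈ B ∪ C, u x = 1 - ‖pr x‖ / s^2),
    (∫ x in Ω,
            (‖gradient u x‖ ^ 2 + ‖gradient u x‖ ^ 2 * ‖gradient f x‖ ^ 2 -
              ⟪gradient u x, gradient f x⟫ ^ 2) /
              Real.sqrt (1 + ‖gradient f x‖ ^ 2)) /
          (∫ y in {y : EuclideanSpace ℝ (Fin m) | ‖y‖ ≤ s^2}, (1 - ‖y‖ / s^2) ^ 2) ≤
          K * s := by
  set v := volume.real (Metric.closedBall (0 : EuclideanSpace ℝ (Fin m)) 1) with hv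
  set v' := volume.real (Metric.closedBall (0 : EuclideanSpace ℝ (Fin (m+1))) 1) with hv'
  have v0 : 0 < v := by
    rw [hv, Measure.real]
    exact ENNReal.toReal_pos (Metric.measure_closedBall_pos _ _ one_pos).ne' measure_closedBall_lt_top.ne
  have v0' : 0 ≤ v' := measureReal_nonneg
  refine ⟨(v' + 7 * v) * 4 * 2 ^ m / v, by positivity, ?_⟩
  intro s hs hs1 q pr A B C Ω f u hpr hA hB hC hΩ hf1 hf2 hu1 hu2
  have hG := G_int m q s hs
  simp only at hG
  change Integrable (GG m q s) ∧ ∫ x, GG m q s x = _ at hG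
  have hd := denom m (s^2) (by positivity)
  rw [← hv] at hd
  have hmeas : MeasurableSet Ω := by
    have c0 : Measurable (fun y : EuclideanSpace ℝ (Fin (m+1)) => y 0) := by fun_prop
    have cp : Measurable (fun y => ‖pr y‖) := by
      rw [hpr]; exact (measurable_snd.comp (spl m).measurable).norm
    have cq : Measurable (fun y : EuclideanSpace ℝ (Fin (m+1)) => ‖y - q‖) := by fun_prop
    rw [hΩ, hA, hB, hC]
    refine ((MeasurableSet.inter ?_ ?_).union (MeasurableSet.inter ?_ (MeasurableSet.inter ?_ ?_))).union
      (MeasurableSet.inter ?_ (MeasurableSet.inter ?_ ?_))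
    · exact measurableSet_le measurable_const c0
    · exact measurableSet_le cq measurable_const
    · exact measurableSet_le measurable_const c0
    · exact measurableSet_le c0 measurable_const
    · exact measurableSet_le cp measurable_const
    · exact measurableSet_le measurable_const c0
    · exact measurableSet_le c0 measurable_const
    · exact measurableSet_le cp measurable_const
  have hnum : (∫ x in Ω,
            (‖gradient u x‖ ^ 2 + ‖gradient u x‖ ^ 2 * ‖gradient f x‖ ^ 2 -
              ⟪gradient u x, gradient f x⟫ ^ 2) /
              Real.sqrt (1 + ‖gradient f x‖ ^ 2)) ≤ ∫ x, GG m q s x := by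
    refine le_trans (integral_mono_of_nonneg (g := GG m q s) (Filter.Eventually.of_forall fun x => num_nonneg _ _)
      hG.1.integrableOn ?_) (setIntegral_le_integral hG.1 (Filter.Eventually.of_forall fun x => GG_nonneg m q s hs x))
    rw [Filter.EventuallyLE, ae_restrict_iff' hmeas]
    have hp : ∀ c, ∀ᵐ x : EuclideanSpace ℝ (Fin (m+1)), ‖pr x‖ ≠ c := by
      rw [hpr]; exact ae_pr_ne m hm
    have hq := ae_norm_ne (m+1) (by omega) q
    filter_upwards [ae_coord_ne m 0, ae_coord_ne m (s^6), ae_coord_ne m (s^6+s^3), hp (s^2), hq (s^2),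
      ae_all_iff.2 (fun k : ℤ => hp (s^6 * (2 * k))), ae_all_iff.2 (fun k : ℤ => hq (s^6 * (2 * k)))] with
      x n1 n2 n3 n4 n5 n6 n7 hx
    exact key m F hFper hF1 hF2 s hs q pr A B C Ω f u hpr hA hB hC hΩ hf1 hf2 hu1 hu2 x hx n1 n2 n3 n4 n5 n6 n7
  rw [hG.2, ← hv, ← hv'] at hnum
  have hdpos : 0 < (1/4) * ((s^2/2) ^ m * v) := by positivity
  rw [div_le_iff₀ (hdpos.trans_le hd)]
  calc _ ≤ _ := hnum
    _ ≤ (v' + 7 * v) * s * (s^2)^m := by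
        have : s⁻¹ * ((s^2)^(m+1) * v') = v' * s * (s^2)^m := by
          rw [pow_succ]; field_simp
        rw [this]
        have h7 : (s^2 + 6 * s) ≤ 7 * s := by nlinarith
        have h8 := mul_le_mul_of_nonneg_right h7 (by positivity : 0 ≤ (s^2)^m * v)
        nlinarith
    _ = (v' + 7 * v) * 4 * 2 ^ m / v * s * ((1/4) * ((s^2/2) ^ m * v)) := by
        rw [div_pow]; field_simp
    _ ≤ _ := by gcongr




/-- The key quantitative estimate: for the deformation function `f`
(built from the sawtooth `F`, the cutoffs `η(t) = max{0, 1−t}`, `γ(t) = max{0, t−δ₁}` and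
the parameters `δ₁ = ε³`, `δ₂ = ε^{3/2}`, `ω = ε⁻³`, `ρ = ε`) and the test function `u`
supported on `Ω = A ∪ B ∪ C`, the Steklov–Rayleigh quotient of the restriction of the
vertical extension of `u` to the graph of `f` is `O(ε^{1/2})`: there are `K > 0` and
`ε₀ > 0`, depending only on `n`, with
`[∫_Ω (‖∇u‖² + ‖∇u‖²‖∇f‖² − ⟨∇u,∇f⟩²)/√(1+‖∇f‖²) dx] / [∫_{‖y‖≤ε} (1−‖y‖/ε)² dy] ≤ K √ε`
for all `0 < ε < ε₀`. -/
theorem stmt_8 (n : ℕ) (hn : 2 ≤ n)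
    (F : ℝ → ℝ) (hFper : ∀ t, F (t + 4) = F t)
    (hF1 : ∀ t ∈ Set.Icc (0 : ℝ) 2, F t = 1 - t)
    (hF2 : ∀ t ∈ Set.Icc (2 : ℝ) 4, F t = t - 3) :
    ∃ K > (0 : ℝ), ∃ ε₀ > (0 : ℝ), ∀ ε : ℝ, 0 < ε → ε < ε₀ →
      ∀ (q : EuclideanSpace ℝ (Fin n))
        (pr : EuclideanSpace ℝ (Fin n) → EuclideanSpace ℝ (Fin (n - 1)))
        (A B C Ω : Set (EuclideanSpace ℝ (Fin n)))
        (f u : EuclideanSpace ℝ (Fin n) → ℝ),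
        q = EuclideanSpace.single (⟨0, by omega⟩ : Fin n) (ε ^ 3 + ε ^ ((3 : ℝ) / 2)) →
        (∀ x i, pr x i = x ⟨i.1 + 1, by have := i.2; omega⟩) →
        A = {x | ε ^ 3 + ε ^ ((3 : ℝ) / 2) ≤ x ⟨0, by omega⟩ ∧ ‖x - q‖ ≤ ε} →
        B = {x | ε ^ 3 ≤ x ⟨0, by omega⟩ ∧
              x ⟨0, by omega⟩ ≤ ε ^ 3 + ε ^ ((3 : ℝ) / 2) ∧ ‖pr x‖ ≤ ε} →
        C = {x | 0 ≤ x ⟨0, by omega⟩ ∧ x ⟨0, by omega⟩ ≤ ε ^ 3 ∧ ‖pr x‖ ≤ ε} →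
        Ω = A ∪ B ∪ C →
        (∀ x : EuclideanSpace ℝ (Fin n), 0 ≤ x ⟨0, by omega⟩ →
          x ⟨0, by omega⟩ ≤ ε ^ 3 + ε ^ ((3 : ℝ) / 2) →
          f x = max 0 (1 - Metric.infDist x Ω / ε) *
            (max 0 (x ⟨0, by omega⟩ - ε ^ 3) * F ((ε ^ 3)⁻¹ * ‖pr x‖))) →
        (∀ x : EuclideanSpace ℝ (Fin n), ε ^ 3 + ε ^ ((3 : ℝ) / 2) ≤ x ⟨0, by omega⟩ →
          f x = max 0 (1 - Metric.infDist x Ω / ε) *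
            (ε ^ ((3 : ℝ) / 2) * F ((ε ^ 3)⁻¹ * ‖x - q‖))) →
        (∀ x ∈ A, u x = 1 - ‖x - q‖ / ε) →
        (∀ x ∈ B ∪ C, u x = 1 - ‖pr x‖ / ε) →
        (∀ x ∉ Ω, u x = 0) →
        (∫ x in Ω,
            (‖gradient u x‖ ^ 2 + ‖gradient u x‖ ^ 2 * ‖gradient f x‖ ^ 2 -
              ⟪gradient u x, gradient f x⟫ ^ 2) /
              Real.sqrt (1 + ‖gradient f x‖ ^ 2)) /
          (∫ y in {y : EuclideanSpace ℝ (Fin (n - 1)) | ‖y‖ ≤ ε}, (1 - ‖y‖ / ε) ^ 2) ≤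
          K * Real.sqrt ε := by
  obtain ⟨m, rfl⟩ : ∃ m, n = m + 1 := ⟨n - 1, by omega⟩
  obtain ⟨K, hK, H⟩ := main_aux m (by omega) F hFper hF1 hF2
  refine ⟨K, hK, 1, one_pos, ?_⟩
  intro ε hε hε1 q pr A B C Ω f u hq hpr hA hB hC hΩ hf1 hf2 hu1 hu2 hu3
  obtain ⟨s, hs, rfl⟩ : ∃ s : ℝ, 0 < s ∧ ε = s ^ 2 :=
    ⟨Real.sqrt ε, Real.sqrt_pos.2 hε, (Real.sq_sqrt hε.le).symm⟩
  have hs1 : s < 1 := by nlinarith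
  have h3 : (s ^ 2 : ℝ) ^ ((3 : ℝ) / 2) = s ^ 3 := by
    rw [← Real.rpow_natCast, ← Real.rpow_mul hs.le, ← Real.rpow_natCast]; norm_num
  have h6 : (s ^ 2) ^ 3 = s ^ 6 := by rw [← pow_mul]
  rw [h3, h6] at hA hB
  rw [h6] at hC
  simp only [h3, h6] at hf1 hf2
  rw [Real.sqrt_sq hs.le]
  refine H s hs hs1 q pr A B C Ω f u ?_ hA hB hC hΩ hf1 hf2 hu1 hu2
  funext x
  ext i
  exact hpr x i
end

section
/- Let n ≥ 1, let C ≥ 1, let U, V ⊆ ℝⁿ be open sets, and let φ : U → V be a C¹ diffeomorphism such that for every p ∈ U and every v ∈ ℝⁿ, (1/C)‖v‖² ≤ ‖Dφ_p(v)‖² ≤ C‖v‖², where Dφ_p is the derivative of φ at p. Then for every C¹ function f : V → ℝ with ∫_V ‖∇f‖² dx < ∞, C^{−(n/2+1)} ∫_V ‖∇f‖² dx ≤ ∫_U ‖∇(f ∘ φ)‖² dx ≤ C^{(n/2+1)} ∫_V ‖∇f‖² dx. -/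
open MeasureTheory

lemma aux_det_le {n : ℕ} (A : EuclideanSpace ℝ (Fin n) →L[ℝ] EuclideanSpace ℝ (Fin n))
    (K : ℝ) (hK : 0 ≤ K) (h : ∀ v, ‖A v‖ ≤ K * ‖v‖) : |A.det| ≤ K ^ n := by
  have h1 := Measure.addHaar_image_continuousLinearMap (volume) A
    (Metric.closedBall (0 : EuclideanSpace ℝ (Fin n)) 1)
  have h2 : A '' (Metric.closedBall 0 1) ⊆ Metric.closedBall 0 K := by
    rintro _ ⟨v, hv, rfl⟩
    rw [mem_closedBall_zero_iff] at hv ⊢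
    exact (h v).trans (mul_le_of_le_one_right hK hv)
  have h3 := measure_mono (μ := volume) h2
  have h4 := Measure.addHaar_closedBall_mul (volume) (0 : EuclideanSpace ℝ (Fin n)) hK
    zero_le_one
  rw [mul_one] at h4
  rw [h1, h4] at h3
  have h5 := (ENNReal.mul_le_mul_iff_left
    (Metric.measure_closedBall_pos volume (0 : EuclideanSpace ℝ (Fin n)) one_pos).ne'
    measure_closedBall_lt_top.ne).1 h3
  rw [ENNReal.ofReal_le_ofReal_iff (by positivity)] at h5
  simpa using h5

lemma aux_le_det {n : ℕ} (A : EuclideanSpace ℝ (Fin n) →L[ℝ] EuclideanSpace ℝ (Fin n))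
    (hA : Function.Surjective A)
    (K : ℝ) (hK : 0 < K) (h : ∀ v, ‖v‖ ≤ K * ‖A v‖) : 1 ≤ K ^ n * |A.det| := by
  have h1 := Measure.addHaar_image_continuousLinearMap (volume) A
    (Metric.closedBall (0 : EuclideanSpace ℝ (Fin n)) K)
  have h2 : Metric.closedBall 0 1 ⊆ A '' (Metric.closedBall 0 K) := by
    intro w hw
    obtain ⟨v, rfl⟩ := hA w
    refine ⟨v, ?_, rfl⟩
    rw [mem_closedBall_zero_iff] at hw ⊢
    exact (h v).trans (mul_le_of_le_one_right hK.le hw)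
  have h3 := measure_mono (μ := volume) h2
  have h4 := Measure.addHaar_closedBall_mul (volume) (0 : EuclideanSpace ℝ (Fin n)) hK.le
    zero_le_one
  rw [mul_one] at h4
  rw [h1, h4, ← mul_assoc, ← ENNReal.ofReal_mul (abs_nonneg _)] at h3
  nth_rewrite 1 [← one_mul (volume (Metric.closedBall (0 : EuclideanSpace ℝ (Fin n)) 1))] at h3
  have h5 := (ENNReal.mul_le_mul_iff_left
    (Metric.measure_closedBall_pos volume (0 : EuclideanSpace ℝ (Fin n)) one_pos).ne'
    measure_closedBall_lt_top.ne).1 h3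
  rw [ENNReal.one_le_ofReal] at h5
  simpa [mul_comm] using h5

lemma aux_norm_gradient {n : ℕ} (f : EuclideanSpace ℝ (Fin n) → ℝ) (x) :
    ‖gradient f x‖ = ‖fderiv ℝ f x‖ := by
  rw [gradient, LinearIsometryEquiv.norm_map]

/-- A `C¹` diffeomorphism `φ : U → V` between open subsets of `ℝⁿ` whose
derivative satisfies `(1/C)‖v‖² ≤ ‖Dφ_p(v)‖² ≤ C‖v‖²` (a quasi-isometry with constant `C`)
distorts the Dirichlet energy of a `C¹` function by at most a factor `C^{n/2+1}`. -/
theorem stmt_11 (n : ℕ) (hn : 1 ≤ n) (C : ℝ) (hC : 1 ≤ C)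
    (U V : Set (EuclideanSpace ℝ (Fin n))) (hUopen : IsOpen U) (hVopen : IsOpen V)
    (φ ψ : EuclideanSpace ℝ (Fin n) → EuclideanSpace ℝ (Fin n))
    (hbij : Set.BijOn φ U V) (hφ : ContDiffOn ℝ 1 φ U) (hψ : ContDiffOn ℝ 1 ψ V)
    (hinv : Set.InvOn ψ φ U V)
    (hqi : ∀ p ∈ U, ∀ v : EuclideanSpace ℝ (Fin n),
      (1 / C) * ‖v‖ ^ 2 ≤ ‖fderiv ℝ φ p v‖ ^ 2 ∧ ‖fderiv ℝ φ p v‖ ^ 2 ≤ C * ‖v‖ ^ 2)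
    (f : EuclideanSpace ℝ (Fin n) → ℝ) (hf : ContDiffOn ℝ 1 f V)
    (hint : IntegrableOn (fun x => ‖gradient f x‖ ^ 2) V) :
    C ^ (-((n : ℝ) / 2 + 1)) * (∫ x in V, ‖gradient f x‖ ^ 2) ≤
        (∫ x in U, ‖gradient (f ∘ φ) x‖ ^ 2) ∧
      (∫ x in U, ‖gradient (f ∘ φ) x‖ ^ 2) ≤
        C ^ ((n : ℝ) / 2 + 1) * (∫ x in V, ‖gradient f x‖ ^ 2) := by
  have hC0 : 0 < C := by linarith
  obtain ⟨K, hK, hKC⟩ : ∃ K : ℝ, 0 < K ∧ K ^ 2 = C :=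
    ⟨√C, Real.sqrt_pos.2 hC0, Real.sq_sqrt hC0.le⟩
  have hpow : C ^ ((n : ℝ) / 2 + 1) = K ^ n * K ^ 2 := by
    rw [← pow_add, ← hKC, ← Real.rpow_natCast, ← Real.rpow_natCast, ← Real.rpow_mul hK.le]
    congr 1
    push_cast
    ring
  have hdφ : ∀ x ∈ U, DifferentiableAt ℝ φ x := fun x hx =>
    (hφ.differentiableOn one_ne_zero).differentiableAt (hUopen.mem_nhds hx)
  have hdf : ∀ x ∈ V, DifferentiableAt ℝ f x := fun x hx =>
    (hf.differentiableOn one_ne_zero).differentiableAt (hVopen.mem_nhds hx)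
  have hup : ∀ p ∈ U, ∀ v, ‖fderiv ℝ φ p v‖ ≤ K * ‖v‖ := by
    intro p hp v
    refine le_of_sq_le_sq ?_ (by positivity)
    rw [mul_pow, hKC]
    exact (hqi p hp v).2
  have hlo : ∀ p ∈ U, ∀ v, ‖v‖ ≤ K * ‖fderiv ℝ φ p v‖ := by
    intro p hp v
    refine le_of_sq_le_sq ?_ (by positivity)
    rw [mul_pow, hKC]
    have := (hqi p hp v).1
    rw [one_div, inv_mul_le_iff₀ hC0] at this
    exact this
  have hsurj : ∀ p ∈ U, Function.Surjective (fderiv ℝ φ p) := by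
    intro p hp
    have : Function.Injective (fderiv ℝ φ p).toLinearMap := by
      rw [injective_iff_map_eq_zero]
      intro v hv
      have h := hlo p hp v
      have hv' : fderiv ℝ φ p v = 0 := hv
      rw [hv'] at h
      simpa using h
    exact LinearMap.injective_iff_surjective.1 this
  have hchain : ∀ p ∈ U, fderiv ℝ (f ∘ φ) p = (fderiv ℝ f (φ p)).comp (fderiv ℝ φ p) :=
    fun p hp => fderiv_comp p (hdf _ (hbij.mapsTo hp)) (hdφ p hp)
  have hH : ∀ p ∈ U, ‖gradient (f ∘ φ) p‖ ^ 2 ≤ K ^ 2 * ‖gradient f (φ p)‖ ^ 2 := by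
    intro p hp
    rw [aux_norm_gradient, aux_norm_gradient, hchain p hp, ← mul_pow]
    gcongr
    refine (ContinuousLinearMap.opNorm_comp_le _ _).trans ?_
    rw [mul_comm]
    gcongr
    exact ContinuousLinearMap.opNorm_le_bound _ hK.le (hup p hp)
  have hG : ∀ p ∈ U, ‖gradient f (φ p)‖ ^ 2 ≤ K ^ 2 * ‖gradient (f ∘ φ) p‖ ^ 2 := by
    intro p hp
    rw [aux_norm_gradient, aux_norm_gradient, hchain p hp, ← mul_pow]
    gcongr
    refine ContinuousLinearMap.opNorm_le_bound _ (by positivity) fun w => ?_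
    obtain ⟨v, rfl⟩ := hsurj p hp w
    have h1 := ((fderiv ℝ f (φ p)).comp (fderiv ℝ φ p)).le_opNorm v
    have h2 := mul_le_mul_of_nonneg_left (hlo p hp v)
      (norm_nonneg ((fderiv ℝ f (φ p)).comp (fderiv ℝ φ p)))
    rw [ContinuousLinearMap.comp_apply] at h1
    linarith
  have hder : ∀ x ∈ U, HasFDerivWithinAt φ (fderiv ℝ φ x) U x := fun x hx =>
    (hdφ x hx).hasFDerivAt.hasFDerivWithinAt
  have hcv := integral_image_eq_integral_abs_det_fderiv_smul volume hUopen.measurableSet hder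
    hbij.injOn (fun x => ‖gradient f x‖ ^ 2)
  have hci := integrableOn_image_iff_integrableOn_abs_det_fderiv_smul volume
    hUopen.measurableSet hder hbij.injOn (fun x => ‖gradient f x‖ ^ 2)
  rw [hbij.image_eq] at hcv hci
  have hi := hci.1 hint
  simp only [smul_eq_mul] at hcv hi
  have hub : ∀ x ∈ U, ‖gradient (f ∘ φ) x‖ ^ 2 ≤
      K ^ n * K ^ 2 * (|(fderiv ℝ φ x).det| * ‖gradient f (φ x)‖ ^ 2) := by
    intro x hx
    have h1 := aux_le_det _ (hsurj x hx) K hK (hlo x hx)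
    calc _ ≤ 1 * (K ^ 2 * ‖gradient f (φ x)‖ ^ 2) := by rw [one_mul]; exact hH x hx
      _ ≤ (K ^ n * |(fderiv ℝ φ x).det|) * (K ^ 2 * ‖gradient f (φ x)‖ ^ 2) := by gcongr
      _ = _ := by ring
  have hlb : ∀ x ∈ U, |(fderiv ℝ φ x).det| * ‖gradient f (φ x)‖ ^ 2 ≤
      K ^ n * K ^ 2 * ‖gradient (f ∘ φ) x‖ ^ 2 := by
    intro x hx
    calc _ ≤ K ^ n * (K ^ 2 * ‖gradient (f ∘ φ) x‖ ^ 2) :=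
          mul_le_mul (aux_det_le _ K hK.le (hup x hx)) (hG x hx) (by positivity) (by positivity)
      _ = _ := by ring
  have hcont : ContinuousOn (fun x => ‖gradient (f ∘ φ) x‖ ^ 2) U := by
    simp only [aux_norm_gradient]
    have := (hf.comp hφ hbij.mapsTo).continuousOn_fderiv_of_isOpen hUopen le_rfl
    exact this.norm.pow 2
  have hi2 := hi.const_mul (K ^ n * K ^ 2)
  have hiH : IntegrableOn (fun x => ‖gradient (f ∘ φ) x‖ ^ 2) U := by
    refine Integrable.mono' hi2 (hcont.aestronglyMeasurable hUopen.measurableSet) ?_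
    refine (ae_restrict_iff' hUopen.measurableSet).2 (.of_forall fun x hx => ?_)
    rw [Real.norm_of_nonneg (by positivity)]
    exact hub x hx
  rw [Real.rpow_neg hC0.le, hpow, hcv]
  constructor
  · rw [inv_mul_le_iff₀ (by positivity), ← integral_const_mul]
    exact setIntegral_mono_on hi (hiH.const_mul _) hUopen.measurableSet hlb
  · rw [← integral_const_mul]
    exact setIntegral_mono_on hiH hi2 hUopen.measurableSet hub
end

section
/- Let n ≥ 2 and let U = {x ∈ ℝⁿ : x₁ ≥ 0, ‖x‖ < 1}, with flat boundary part ∂₀U = {x ∈ U : x₁ = 0}, identified with {y ∈ ℝ^{n−1} : ‖y‖ < 1}. Then for every k ∈ ℕ and every η > 0 there exist a Lipschitz function f : U → ℝ with |f(x)| < 1 for all x, whose support is a compact subset of the interior {x ∈ ℝⁿ : x₁ > 0, ‖x‖ < 1} (in particular f vanishes in a neighborhood of ∂U), and Lipschitz functions u₀, u₁, …, u_k : U → ℝ with pairwise disjoint supports, each satisfying ∫_{∂₀U} u_i(0, y)² dy > 0, such that for every i ∈ {0, …, k}: ∫_U (‖∇u_i‖² + ‖∇u_i‖²‖∇f‖²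 − ⟨∇u_i, ∇f⟩²)/√(1 + ‖∇f‖²) dx ≤ η ∫_{∂₀U} u_i(0, y)² dy. -/
open MeasureTheory RealInnerProductSpace

open Filter Topology

noncomputable def saw (t : ℝ) : ℝ := |t - round t|

lemma saw_nonneg (t : ℝ) : 0 ≤ saw t := abs_nonneg _

lemma saw_le_s13 (t : ℝ) : saw t ≤ 1 / 2 := abs_sub_round t

lemma saw_sub_le (s t : ℝ) : |saw s - saw t| ≤ |s - t| := by
  have key : ∀ s t : ℝ, saw s ≤ |s - t| + saw t := by
    intro s t
    calc saw s ≤ |s - round t| := round_le s _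
      _ = |(s - t) + (t - round t)| := by ring_nf
      _ ≤ _ := abs_add_le _ _
  rw [abs_sub_le_iff]
  have h1 := key s t
  have h2 := key t s
  rw [abs_sub_comm t s] at h2
  constructor <;> linarith

lemma saw_deriv_s13 (t : ℝ) (ht : ∀ m : ℤ, 2 * t ≠ m) : ∃ d : ℝ, |d| = 1 ∧ HasDerivAt saw d t := by
  set r := round t with hr
  have h0 : t - r ≠ 0 := by
    intro h
    apply ht (2 * r)
    push_cast
    linarith
  have h1 := (round_eq_iff (x := t) (n := r)).1 hr.symm
  have h2 : t ≠ r - 1 / 2 := by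
    intro h
    apply ht (2 * r - 1)
    push_cast
    linarith
  have hmem : Set.Ioo ((r : ℝ) - 1 / 2) (r + 1 / 2) ∈ 𝓝 t :=
    isOpen_Ioo.mem_nhds ⟨lt_of_le_of_ne h1.1 (Ne.symm h2), h1.2⟩
  have hev : saw =ᶠ[𝓝 t] fun s => |s - r| := by
    filter_upwards [hmem] with s hs
    have : round s = r := round_eq_iff.2 ⟨hs.1.le, hs.2⟩
    simp [saw, this]
  have hd : HasDerivAt (fun s : ℝ => s - r) 1 t := (hasDerivAt_id t).sub_const _
  have hd2 := (hasDerivAt_abs h0).comp t hd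
  refine ⟨_, ?_, hd2.congr_of_eventuallyEq hev⟩
  rcases lt_or_gt_of_ne h0 with h | h
  · simp [sign_neg h]
  · simp [sign_pos h]

section
variable {E : Type*} [NormedAddCommGroup E] [InnerProductSpace ℝ E] [CompleteSpace E]

lemma inner_gradient (f : E → ℝ) (x v : E) : ⟪gradient f x, v⟫ = fderiv ℝ f x v := by
  rw [← toDual_gradient]
  simp

lemma norm_gradient (f : E → ℝ) (x : E) : ‖gradient f x‖ = ‖fderiv ℝ f x‖ :=
  (InnerProductSpace.toDual ℝ E).symm.norm_map _

lemma perp_bound (f : E → ℝ) (x e : E) (he : ‖e‖ = 1) (C : ℝ) (hC : 0 ≤ C)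
    (h : ∀ v : E, ⟪e, v⟫ = 0 → |f (x + v) - f x| ≤ C * ‖v‖) :
    ‖gradient f x - ⟪e, gradient f x⟫ • e‖ ≤ C := by
  by_cases hd : DifferentiableAt ℝ f x
  · set w := gradient f x - ⟪e, gradient f x⟫ • e with hw
    have hee : ⟪e, e⟫ = 1 := by rw [real_inner_self_eq_norm_sq, he]; norm_num
    have hew : ⟪e, w⟫ = 0 := by
      rw [hw, inner_sub_right, inner_smul_right, hee]; ring
    have hgw : ⟪gradient f x, w⟫ = ‖w‖ ^ 2 := by
      have : gradient f x = w + ⟪e, gradient f x⟫ • e := by rw [hw]; abel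
      conv_lhs => rw [this]
      rw [inner_add_left, inner_smul_left, hew, real_inner_self_eq_norm_sq]; simp
    have hl : HasDerivAt (fun t : ℝ => f (x + t • w)) (fderiv ℝ f x w) 0 :=
      (hd.hasFDerivAt.hasLineDerivAt w)
    have hb := hl.le_of_lip' (C := C * ‖w‖) (by positivity) (by
      refine Eventually.of_forall fun t => ?_
      have := h (t • w) (by rw [inner_smul_right, hew, mul_zero])
      simp only [zero_smul, add_zero, sub_zero, Real.norm_eq_abs]
      rw [norm_smul, Real.norm_eq_abs] at this
      linarith)
    rw [← inner_gradient, hgw, Real.norm_eq_abs, abs_of_nonneg (by positivity)] at hb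
    by_contra hcon
    push Not at hcon
    have : 0 < ‖w‖ := by linarith
    nlinarith
  · rw [gradient_eq_zero_of_not_differentiableAt hd]
    simpa using hC

lemma numer_bound (p q e : E) (he : ‖e‖ = 1) (hp : ‖p‖ ≤ 1)
    (hpe : ‖p - ⟪e, p⟫ • e‖ ≤ 0) (hq : ‖q - ⟪e, q⟫ • e‖ ≤ 1) :
    0 ≤ ‖p‖ ^ 2 + ‖p‖ ^ 2 * ‖q‖ ^ 2 - ⟪p, q⟫ ^ 2 ∧
    ‖p‖ ^ 2 + ‖p‖ ^ 2 * ‖q‖ ^ 2 - ⟪p, q⟫ ^ 2 ≤ 2 := by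
  have hpc : p = ⟪e, p⟫ • e := by
    rw [← sub_eq_zero]; exact norm_le_zero_iff.1 hpe
  set c := ⟪e, p⟫ with hc
  have h1 : ‖q - ⟪e, q⟫ • e‖ ^ 2 = ‖q‖ ^ 2 - ⟪e, q⟫ ^ 2 := by
    rw [norm_sub_sq_real, norm_smul, inner_smul_right, he, real_inner_comm, mul_one,
      Real.norm_eq_abs, sq_abs]; ring
  have h2 : ‖q - ⟪e, q⟫ • e‖ ^ 2 ≤ 1 := by
    have := norm_nonneg (q - ⟪e, q⟫ • e)
    nlinarith
  have h3 : ‖p‖ ^ 2 = c ^ 2 := by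
    rw [hpc, norm_smul, he, mul_one, Real.norm_eq_abs, sq_abs]
  have h4 : ⟪p, q⟫ = c * ⟪e, q⟫ := by
    rw [hpc, inner_smul_left]; simp
  have h5 : c ^ 2 ≤ 1 := by
    rw [← h3]; have := norm_nonneg p; nlinarith
  have h6 := sq_nonneg ‖q - ⟪e, q⟫ • e‖
  have h7 := sq_nonneg c
  rw [h3, h4]
  constructor <;> nlinarith
end

lemma good_bound {n : ℕ} (b : Fin n) (ε N : ℝ) (hε : 0 < ε) (hN : 0 < N)
    (f : EuclideanSpace ℝ (Fin n) → ℝ)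
    (x : EuclideanSpace ℝ (Fin n)) (hx : ∀ m : ℤ, 2 * (N * x b) ≠ m)
    (hf : f =ᶠ[𝓝 x] fun z => ε * saw (N * z b)) : ε * N ≤ ‖gradient f x‖ := by
  obtain ⟨d, hd, hs⟩ := saw_deriv_s13 _ hx
  have hp : HasFDerivAt (fun z : EuclideanSpace ℝ (Fin n) => N * z b)
      (N • (EuclideanSpace.proj b : EuclideanSpace ℝ (Fin n) →L[ℝ] ℝ)) x :=
    ((EuclideanSpace.proj b : EuclideanSpace ℝ (Fin n) →L[ℝ] ℝ).hasFDerivAt).const_mul N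
  have h1 := ((hs.comp_hasFDerivAt x hp).const_mul ε).congr_of_eventuallyEq hf
  rw [norm_gradient, h1.fderiv]
  refine le_trans ?_ (ContinuousLinearMap.unit_le_opNorm _ (EuclideanSpace.single b (1 : ℝ)) (by simp))
  simp [hd, abs_of_pos hε, abs_of_pos hN]

lemma null_hyper {n : ℕ} (a : Fin n) (c : ℝ) :
    volume {x : EuclideanSpace ℝ (Fin n) | x a = c} = 0 := by
  have h1 := (Measure.quasiMeasurePreserving_eval (fun _ : Fin n => (volume : Measure ℝ)) a)
  have h2 := h1.comp (EuclideanSpace.volume_preserving_symm_measurableEquiv_toLp (Fin n)).quasiMeasurePreserving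
  exact h2.preimage_null (s := {c}) (by simp)

lemma ae_good {n : ℕ} (b : Fin n) (N : ℝ) (hN : 0 < N) :
    ∀ᵐ x : EuclideanSpace ℝ (Fin n), ∀ m : ℤ, 2 * (N * x b) ≠ m := by
  rw [ae_all_iff]
  intro m
  rw [ae_iff]
  refine measure_mono_null ?_ (null_hyper b (m / (2 * N)))
  intro x hx
  simp only [not_not, Set.mem_ofPred_eq, ne_eq] at hx ⊢
  rw [eq_div_iff (by positivity)]
  linarith

noncomputable def sfun {n : ℕ} (a : Fin n) (x : EuclideanSpace ℝ (Fin n)) : ℝ :=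
  min (x a) (1 - ‖x‖)

lemma sfun_cont {n : ℕ} (a : Fin n) : Continuous (sfun a) := by
  unfold sfun; fun_prop

lemma coord_le {n : ℕ} (a : Fin n) (x y : EuclideanSpace ℝ (Fin n)) : |x a - y a| ≤ ‖x - y‖ := by
  have := PiLp.norm_apply_le (x - y) a
  simpa using this

lemma sfun_lip {n : ℕ} (a : Fin n) (x y : EuclideanSpace ℝ (Fin n)) :
    |sfun a x - sfun a y| ≤ ‖x - y‖ := by
  refine (abs_min_sub_min_le_max _ _ _ _).trans (max_le (coord_le a x y) ?_)
  have : (1 - ‖x‖) - (1 - ‖y‖) = -(‖x‖ - ‖y‖) := by ring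
  rw [this, abs_neg]
  exact abs_norm_sub_norm_le x y

noncomputable def cut {n : ℕ} (a : Fin n) (δ : ℝ) (x : EuclideanSpace ℝ (Fin n)) : ℝ :=
  max 0 (min 1 (sfun a x / δ - 1))

lemma cut_nonneg {n : ℕ} (a : Fin n) (δ : ℝ) (x : EuclideanSpace ℝ (Fin n)) :
    0 ≤ cut a δ x := le_max_left _ _

lemma cut_le {n : ℕ} (a : Fin n) (δ : ℝ) (x : EuclideanSpace ℝ (Fin n)) :
    cut a δ x ≤ 1 := max_le zero_le_one (min_le_left _ _)

lemma cut_lip {n : ℕ} (a : Fin n) (δ : ℝ) (hδ : 0 < δ) (x y : EuclideanSpace ℝ (Fin n)) :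
    |cut a δ x - cut a δ y| ≤ ‖x - y‖ / δ := by
  have hnn : 0 ≤ ‖x - y‖ / δ := by positivity
  refine (abs_max_sub_max_le_max _ _ _ _).trans (max_le (by simpa using hnn) ?_)
  refine (abs_min_sub_min_le_max _ _ _ _).trans (max_le (by simpa using hnn) ?_)
  have : sfun a x / δ - 1 - (sfun a y / δ - 1) = (sfun a x - sfun a y) / δ := by ring
  rw [this, abs_div, abs_of_pos hδ]
  gcongr
  exact sfun_lip a x y

lemma cut_eq_one {n : ℕ} (a : Fin n) (δ : ℝ) (hδ : 0 < δ) (x : EuclideanSpace ℝ (Fin n))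
    (h : 2 * δ < sfun a x) : cut a δ x = 1 := by
  have : 1 ≤ sfun a x / δ - 1 := by
    rw [le_sub_iff_add_le, le_div_iff₀ hδ]; linarith
  simp [cut, min_eq_left this]

lemma cut_eq_zero {n : ℕ} (a : Fin n) (δ : ℝ) (hδ : 0 < δ) (x : EuclideanSpace ℝ (Fin n))
    (h : sfun a x ≤ δ) : cut a δ x = 0 := by
  have : sfun a x / δ - 1 ≤ 0 := by
    rw [sub_nonpos, div_le_one hδ]; exact h
  rw [cut, max_eq_left]
  exact (min_le_right _ _).trans this

lemma exists_delta {n : ℕ} (a : Fin n) (κ : ℝ) (hκ : 0 < κ) : ∃ δ : ℝ, 0 < δ ∧ δ ≤ 1 ∧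
    (volume {x : EuclideanSpace ℝ (Fin n) | (0 ≤ x a ∧ ‖x‖ < 1) ∧ sfun a x ≤ 2 * δ}).toReal ≤ κ := by
  set S : ℕ → Set (EuclideanSpace ℝ (Fin n)) := fun m =>
    {x | (0 ≤ x a ∧ ‖x‖ < 1) ∧ sfun a x ≤ 2 * (1 / ((m : ℝ) + 1))} with hS
  have hm : ∀ m, MeasurableSet (S m) := by
    intro m
    have h1 : MeasurableSet {x : EuclideanSpace ℝ (Fin n) | 0 ≤ x a} :=
      (isClosed_le continuous_const (by fun_prop)).measurableSet
    have h2 : MeasurableSet {x : EuclideanSpace ℝ (Fin n) | ‖x‖ < 1} :=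
      (isOpen_lt (by fun_prop) continuous_const).measurableSet
    have h3 : MeasurableSet {x : EuclideanSpace ℝ (Fin n) | sfun a x ≤ 2 * (1 / ((m : ℝ) + 1))} :=
      (isClosed_le (sfun_cont a) continuous_const).measurableSet
    exact (h1.inter h2).inter h3
  have hanti : Antitone S := by
    intro m m' h x hx
    refine ⟨hx.1, hx.2.trans ?_⟩
    have : (m : ℝ) ≤ m' := by exact_mod_cast h
    gcongr
  have hfin : ∀ m, volume (S m) ≠ ⊤ := by
    intro m
    refine ne_top_of_le_ne_top (measure_ball_lt_top (x := (0 : EuclideanSpace ℝ (Fin n))) (r := 1)).ne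
      (measure_mono ?_)
    intro x hx
    simpa using hx.1.2
  have ht := tendsto_measure_iInter_atTop (fun m => (hm m).nullMeasurableSet) hanti ⟨0, hfin 0⟩
  have h0 : volume (⋂ m, S m) = 0 := by
    refine measure_mono_null ?_ (null_hyper a 0)
    intro x hx
    rw [Set.mem_iInter] at hx
    have hle : sfun a x ≤ 0 := by
      have hl : Tendsto (fun m : ℕ => 2 * (1 / ((m : ℝ) + 1))) atTop (𝓝 (2 * 0)) :=
        tendsto_one_div_add_atTop_nhds_zero_nat.const_mul 2
      rw [mul_zero] at hl
      exact ge_of_tendsto' hl fun m => (hx m).2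
    have hx0 := (hx 0).1
    rcases min_le_iff.1 hle with h | h
    · exact le_antisymm h hx0.1
    · linarith [hx0.2]
  rw [h0] at ht
  have hev := ht.eventually (gt_mem_nhds (ENNReal.ofReal_pos.2 hκ))
  obtain ⟨m, hm'⟩ := hev.exists
  refine ⟨1 / ((m : ℝ) + 1), by positivity, ?_, ENNReal.toReal_le_of_le_ofReal hκ.le hm'.le⟩
  rw [div_le_one (by positivity)]
  have : (0 : ℝ) ≤ m := by positivity
  linarith

noncomputable def tent (k : ℕ) (i : ℕ) (t : ℝ) : ℝ :=
  max 0 (1 / (2 * ((k : ℝ) + 1)) - |t - i / ((k : ℝ) + 1)|)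

lemma tent_lip (k i : ℕ) (s t : ℝ) : |tent k i s - tent k i t| ≤ |s - t| := by
  refine (abs_max_sub_max_le_max _ _ _ _).trans (max_le (by simp) ?_)
  rw [sub_sub_sub_cancel_left, abs_sub_comm s t]
  refine (abs_abs_sub_abs_le_abs_sub _ _).trans (le_of_eq ?_)
  ring_nf

lemma tent_cont (k i : ℕ) : Continuous (tent k i) := by
  unfold tent; fun_prop

lemma tent_supp (k i : ℕ) (t : ℝ) (h : tent k i t ≠ 0) : |t * ((k : ℝ) + 1) - i| < 1 / 2 := by
  have hk : (0 : ℝ) < (k : ℝ) + 1 := by positivity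
  by_contra hcon
  push Not at hcon
  apply h
  rw [tent, max_eq_left]
  have : t - i / ((k : ℝ) + 1) = (t * ((k : ℝ) + 1) - i) / ((k : ℝ) + 1) := by field_simp
  rw [this, abs_div, abs_of_pos hk, sub_nonpos, div_le_div_iff₀ (by positivity) hk]
  nlinarith

lemma tent_disj (k i j : ℕ) (t : ℝ) (hi : tent k i t ≠ 0) (hj : tent k j t ≠ 0) : i = j := by
  have h1 := abs_lt.1 (tent_supp k i t hi)
  have h2 := abs_lt.1 (tent_supp k j t hj)
  have h3 : (i : ℝ) < j + 1 := by linarith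
  have h4 : (j : ℝ) < i + 1 := by linarith
  have h5 : i < j + 1 := by exact_mod_cast h3
  have h6 : j < i + 1 := by exact_mod_cast h4
  omega

lemma bdry_pos {m : ℕ} (c : Fin m) (k i : ℕ) (hi : i ≤ k) :
    0 < ∫ y in {y : EuclideanSpace ℝ (Fin m) | ‖y‖ < 1}, (tent k i (y c)) ^ 2 := by
  have hk : (0 : ℝ) < (k : ℝ) + 1 := by positivity
  have hcont : Continuous fun y : EuclideanSpace ℝ (Fin m) => (tent k i (y c)) ^ 2 := by
    have := tent_cont k i
    fun_prop
  have hset : {y : EuclideanSpace ℝ (Fin m) | ‖y‖ < 1} = Metric.ball 0 1 := by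
    ext y; simp
  have hint : IntegrableOn (fun y : EuclideanSpace ℝ (Fin m) => (tent k i (y c)) ^ 2)
      {y : EuclideanSpace ℝ (Fin m) | ‖y‖ < 1} := by
    rw [hset]
    exact (hcont.continuousOn.integrableOn_compact (isCompact_closedBall 0 1)).mono_set
      Metric.ball_subset_closedBall
  rw [setIntegral_pos_iff_support_of_nonneg_ae (Eventually.of_forall fun y => sq_nonneg _) hint]
  refine IsOpen.measure_pos _ (hcont.isOpen_support.inter (isOpen_lt (by fun_prop) continuous_const))
    ⟨EuclideanSpace.single c ((i : ℝ) / (k + 1)), ?_, ?_⟩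
  · have : tent k i ((i : ℝ) / (k + 1)) ≠ 0 := by
      have : (0 : ℝ) < 1 / (2 * ((k : ℝ) + 1)) := by positivity
      simp only [tent, sub_self, abs_zero, sub_zero]
      rw [max_eq_right this.le]; exact this.ne'
    simpa using this
  · have h0 : (0 : ℝ) ≤ (i : ℝ) / (k + 1) := by positivity
    have h2 : (i : ℝ) ≤ k := by exact_mod_cast hi
    have h1 : (i : ℝ) / (k + 1) < 1 := by rw [div_lt_one hk]; linarith
    show ‖EuclideanSpace.single c ((i : ℝ) / (k + 1))‖ < 1
    rw [EuclideanSpace.norm_single, Real.norm_eq_abs, abs_of_nonneg h0]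
    exact h1

/-- On the flat half-ball `U = {x ∈ ℝⁿ : x₁ ≥ 0, ‖x‖ < 1}` with flat
boundary part `∂₀U = {x ∈ U : x₁ = 0} ≅ {y ∈ ℝ^{n−1} : ‖y‖ < 1}`: for every `k` and every
`η > 0` there exist a Lipschitz deformation function `f` with `|f| < 1`, compactly
supported in the interior `{x₁ > 0, ‖x‖ < 1}`, and Lipschitz test functions
`u₀, …, u_k` with pairwise disjoint supports and positive boundary `L²` norms, whose graph
Dirichlet energies satisfy
`∫_U (‖∇uᵢ‖² + ‖∇uᵢ‖²‖∇f‖² − ⟨∇uᵢ, ∇f⟩²)/√(1 + ‖∇f‖²) dx ≤ η ∫_{∂₀U} uᵢ(0, y)² dy`. -/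
theorem stmt_13 (n : ℕ) (hn : 2 ≤ n)
    (U : Set (EuclideanSpace ℝ (Fin n)))
    (hU : U = {x | 0 ≤ x ⟨0, by omega⟩ ∧ ‖x‖ < 1})
    (emb0 : EuclideanSpace ℝ (Fin (n - 1)) → EuclideanSpace ℝ (Fin n))
    (hemb0 : ∀ y j, emb0 y j =
      if h : j.1 = 0 then 0 else y ⟨j.1 - 1, by have := j.2; omega⟩)
    (k : ℕ) (η : ℝ) (hη : 0 < η) :
    ∃ f : EuclideanSpace ℝ (Fin n) → ℝ,
      (∃ K : NNReal, LipschitzWith K f) ∧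
      (∀ x, |f x| < 1) ∧
      IsCompact (tsupport f) ∧
      tsupport f ⊆ {x | 0 < x ⟨0, by omega⟩ ∧ ‖x‖ < 1} ∧
      ∃ u : Fin (k + 1) → EuclideanSpace ℝ (Fin n) → ℝ,
        (∀ i, ∃ K : NNReal, LipschitzWith K (u i)) ∧
        (∀ i j, i ≠ j →
          Disjoint (Function.support (u i)) (Function.support (u j))) ∧
        (∀ i, 0 < ∫ y in {y : EuclideanSpace ℝ (Fin (n - 1)) | ‖y‖ < 1},
          (u i (emb0 y)) ^ 2) ∧
        (∀ i, (∫ x in U,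
            (‖gradient (u i) x‖ ^ 2 +
              ‖gradient (u i) x‖ ^ 2 * ‖gradient f x‖ ^ 2 -
              ⟪gradient (u i) x, gradient f x⟫ ^ 2) /
              Real.sqrt (1 + ‖gradient f x‖ ^ 2)) ≤
          η * ∫ y in {y : EuclideanSpace ℝ (Fin (n - 1)) | ‖y‖ < 1},
            (u i (emb0 y)) ^ 2) := by
  classical
  set a : Fin n := ⟨0, by omega⟩ with ha
  set b : Fin n := ⟨1, by omega⟩ with hb
  set c : Fin (n - 1) := ⟨0, by omega⟩ with hc
  have hembb : ∀ y, emb0 y b = y c := by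
    intro y
    rw [hemb0]
    simp [hb, hc]
  have hab : a ≠ b := by simp [ha, hb]
  -- boundary masses
  set B : Fin (k + 1) → ℝ := fun i =>
    ∫ y in {y : EuclideanSpace ℝ (Fin (n - 1)) | ‖y‖ < 1}, (tent k i (y c)) ^ 2 with hB
  have hBpos : ∀ i, 0 < B i := fun i => bdry_pos c k i (by have := i.2; omega)
  obtain ⟨i₀, hi₀⟩ := Finite.exists_min B
  set β := B i₀ with hβ
  have hβpos : 0 < β := hBpos i₀
  have hUm : MeasurableSet U := by
    rw [hU]
    have h1 : MeasurableSet {x : EuclideanSpace ℝ (Fin n) | 0 ≤ x a} :=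
      (isClosed_le continuous_const (by fun_prop)).measurableSet
    have h2 : MeasurableSet {x : EuclideanSpace ℝ (Fin n) | ‖x‖ < 1} :=
      (isOpen_lt (by fun_prop) continuous_const).measurableSet
    exact h1.inter h2
  have hUfin : volume U ≠ ⊤ := by
    refine ne_top_of_le_ne_top (measure_ball_lt_top (x := (0 : EuclideanSpace ℝ (Fin n))) (r := 1)).ne
      (measure_mono ?_)
    intro x hx
    rw [hU] at hx
    simpa using hx.2
  set W := (volume U).toReal with hW
  have hW0 : 0 ≤ W := ENNReal.toReal_nonneg
  obtain ⟨δ, hδ, hδ1, hδv⟩ := exists_delta a (η * β / 4) (by positivity)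
  set M : ℝ := 4 * (W + 1) / (η * β) with hM
  have hMpos : 0 < M := by positivity
  set N : ℝ := M / δ with hN
  have hNpos : 0 < N := by positivity
  set f : EuclideanSpace ℝ (Fin n) → ℝ := fun x => cut a δ x * (δ * saw (N * x b)) with hf
  have hflip : ∀ x y, |f x - f y| ≤ (1 + M) * ‖x - y‖ := by
    intro x y
    have h1 : f x - f y = (cut a δ x - cut a δ y) * (δ * saw (N * x b)) +
        cut a δ y * (δ * (saw (N * x b) - saw (N * y b))) := by simp only [hf]; ring
    have h2 : |saw (N * x b) - saw (N * y b)| ≤ N * ‖x - y‖ := by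
      refine (saw_sub_le _ _).trans ?_
      rw [← mul_sub, abs_mul, abs_of_pos hNpos]
      gcongr
      exact coord_le b x y
    have h3 : |(cut a δ x - cut a δ y) * (δ * saw (N * x b))| ≤ ‖x - y‖ / δ * (δ * 1) := by
      rw [abs_mul, abs_mul, abs_of_pos hδ, abs_of_nonneg (saw_nonneg _)]
      have := saw_le_s13 (N * x b)
      have := saw_nonneg (N * x b)
      have := cut_lip a δ hδ x y
      gcongr
      linarith
    have h4 : |cut a δ y * (δ * (saw (N * x b) - saw (N * y b)))| ≤ 1 * (δ * (N * ‖x - y‖)) := by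
      rw [abs_mul, abs_mul, abs_of_pos hδ, abs_of_nonneg (cut_nonneg a δ y)]
      have := cut_le a δ y
      gcongr
    have h5 : ‖x - y‖ / δ * (δ * 1) = ‖x - y‖ := by field_simp
    have h6 : 1 * (δ * (N * ‖x - y‖)) = M * ‖x - y‖ := by rw [hN]; field_simp
    rw [h1]
    refine (abs_add_le _ _).trans ?_
    linarith
  have hfperp : ∀ x v : EuclideanSpace ℝ (Fin n), v b = 0 → |f (x + v) - f x| ≤ 1 * ‖v‖ := by
    intro x v hv
    have h1 : f (x + v) - f x = (cut a δ (x + v) - cut a δ x) * (δ * saw (N * x b)) := by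
      simp only [hf, PiLp.add_apply, hv, add_zero]; ring
    have h3 : |(cut a δ (x + v) - cut a δ x) * (δ * saw (N * x b))| ≤ ‖v‖ / δ * (δ * 1) := by
      rw [abs_mul, abs_mul, abs_of_pos hδ, abs_of_nonneg (saw_nonneg _)]
      have := saw_le_s13 (N * x b)
      have := saw_nonneg (N * x b)
      have h := cut_lip a δ hδ (x + v) x
      rw [add_sub_cancel_left] at h
      gcongr
      linarith
    have h5 : ‖v‖ / δ * (δ * 1) = ‖v‖ := by field_simp
    rw [h1]
    linarith
  have hts : tsupport f ⊆ {x | δ ≤ sfun a x} := by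
    refine closure_minimal ?_ (isClosed_le continuous_const (sfun_cont a))
    intro x hx
    by_contra hcon
    apply hx
    have : sfun a x ≤ δ := le_of_lt (not_le.1 hcon)
    simp [hf, cut_eq_zero a δ hδ x this]
  have hsub : {x | δ ≤ sfun a x} ⊆ {x : EuclideanSpace ℝ (Fin n) | 0 < x a ∧ ‖x‖ < 1} := by
    intro x hx
    have h : δ ≤ min (x a) (1 - ‖x‖) := hx
    rw [le_min_iff] at h
    exact ⟨by linarith, by linarith⟩
  refine ⟨f, ⟨⟨1 + M, by positivity⟩, LipschitzWith.of_dist_le_mul fun x y => ?_⟩, ?_, ?_,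
    hts.trans hsub, fun i x => tent k i (x b), ?_, ?_, ?_, ?_⟩
  · rw [Real.dist_eq, dist_eq_norm]
    exact hflip x y
  · intro x
    have h1 := cut_nonneg a δ x
    have h2 := cut_le a δ x
    have h3 := saw_nonneg (N * x b)
    have h4 := saw_le_s13 (N * x b)
    have h5 : δ * saw (N * x b) ≤ 1 * (1 / 2) := by gcongr
    have h6 : 0 ≤ δ * saw (N * x b) := by positivity
    have h7 : 0 ≤ f x := mul_nonneg h1 h6
    rw [abs_of_nonneg h7]
    have : f x ≤ 1 * (δ * saw (N * x b)) := by simp only [hf]; gcongr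
    linarith
  · refine Metric.isCompact_of_isClosed_isBounded (isClosed_tsupport f) ?_
    refine (Metric.isBounded_ball (x := (0 : EuclideanSpace ℝ (Fin n))) (r := 1)).subset ?_
    intro x hx
    simpa using (hsub (hts hx)).2
  · intro i
    refine ⟨1, LipschitzWith.of_dist_le_mul fun x y => ?_⟩
    rw [Real.dist_eq, dist_eq_norm, NNReal.coe_one, one_mul]
    exact (tent_lip _ _ _ _).trans (coord_le b x y)
  · intro i j hij
    rw [Set.disjoint_left]
    intro x hx hx'
    exact hij (Fin.ext (tent_disj k i j _ hx hx'))
  · intro i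
    simp only [hembb]
    exact hBpos i
  · intro i
    simp only [hembb]
    have hBi : β ≤ B i := hi₀ i
    refine le_trans ?_ (mul_le_mul_of_nonneg_left hBi hη.le)
    set u : EuclideanSpace ℝ (Fin n) → ℝ := fun x => tent k i (x b) with hu
    set e : EuclideanSpace ℝ (Fin n) := EuclideanSpace.single b (1 : ℝ) with he
    have hen : ‖e‖ = 1 := by simp [he]
    have hev : ∀ v : EuclideanSpace ℝ (Fin n), ⟪e, v⟫ = 0 → v b = 0 := by
      intro v hv
      simpa [he, EuclideanSpace.inner_single_left] using hv
    have hulip : LipschitzWith 1 u := LipschitzWith.of_dist_le_mul fun x y => by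
      rw [Real.dist_eq, dist_eq_norm, NNReal.coe_one, one_mul]
      exact (tent_lip _ _ _ _).trans (coord_le b x y)
    have hnum : ∀ x, 0 ≤ ‖gradient u x‖ ^ 2 + ‖gradient u x‖ ^ 2 * ‖gradient f x‖ ^ 2 -
          ⟪gradient u x, gradient f x⟫ ^ 2 ∧
        ‖gradient u x‖ ^ 2 + ‖gradient u x‖ ^ 2 * ‖gradient f x‖ ^ 2 -
          ⟪gradient u x, gradient f x⟫ ^ 2 ≤ 2 := by
      intro x
      refine numer_bound _ _ e hen ?_ ?_ ?_
      · rw [norm_gradient]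
        simpa using norm_fderiv_le_of_lipschitz ℝ hulip (x₀ := x)
      · refine perp_bound u x e hen 0 le_rfl fun v hv => ?_
        simp [hu, hev v hv]
      · exact perp_bound f x e hen 1 zero_le_one fun v hv => hfperp x v (hev v hv)
    set S : Set (EuclideanSpace ℝ (Fin n)) := {x | sfun a x ≤ 2 * δ} with hS
    have hSm : MeasurableSet S := (isClosed_le (sfun_cont a) continuous_const).measurableSet
    have hSv : (volume (S ∩ U)).toReal ≤ η * β / 4 := by
      have : S ∩ U = {x : EuclideanSpace ℝ (Fin n) | (0 ≤ x a ∧ ‖x‖ < 1) ∧ sfun a x ≤ 2 * δ} := by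
        rw [hU, Set.inter_comm]; rfl
      rw [this]; exact hδv
    haveI : IsFiniteMeasure (volume.restrict U) := ⟨by simpa using hUfin.lt_top⟩
    have hi1 : Integrable (S.indicator fun _ => (2 : ℝ)) (volume.restrict U) :=
      (integrable_const 2).indicator hSm
    have hi2 : Integrable (fun _ => 2 / M) (volume.restrict U) := integrable_const _
    have hle := integral_mono_of_nonneg (μ := volume.restrict U)
      (f := fun x => (‖gradient u x‖ ^ 2 + ‖gradient u x‖ ^ 2 * ‖gradient f x‖ ^ 2 -
          ⟪gradient u x, gradient f x⟫ ^ 2) / Real.sqrt (1 + ‖gradient f x‖ ^ 2))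
      (g := fun x => S.indicator (fun _ => (2 : ℝ)) x + 2 / M)
      (Eventually.of_forall fun x => div_nonneg (hnum x).1 (Real.sqrt_nonneg _))
      (hi1.add hi2) (by
        filter_upwards [ae_restrict_of_ae (ae_good b N hNpos)] with x hx
        by_cases hxS : x ∈ S
        · rw [Set.indicator_of_mem hxS]
          have h1 : 1 ≤ Real.sqrt (1 + ‖gradient f x‖ ^ 2) := by
            rw [Real.one_le_sqrt]; nlinarith [sq_nonneg ‖gradient f x‖]
          have h2 := div_le_self (hnum x).1 h1
          have h3 : 0 ≤ 2 / M := by positivity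
          linarith [(hnum x).2]
        · rw [Set.indicator_of_notMem hxS, zero_add]
          have hlt : 2 * δ < sfun a x := not_le.1 hxS
          have hgood := good_bound b δ N hδ hNpos f x hx (by
            filter_upwards [(isOpen_lt continuous_const (sfun_cont a)).mem_nhds hlt] with z hz
            simp only [hf, cut_eq_one a δ hδ z hz, one_mul])
          have hMN : δ * N = M := by rw [hN]; field_simp
          rw [hMN] at hgood
          have h1 : M ≤ Real.sqrt (1 + ‖gradient f x‖ ^ 2) := by
            apply Real.le_sqrt_of_sq_le
            nlinarith
          exact div_le_div₀ (by norm_num) (hnum x).2 hMpos h1)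
    refine hle.trans ?_
    rw [integral_add hi1 hi2, integral_indicator hSm, setIntegral_const, integral_const]
    simp only [smul_eq_mul, measureReal_def, Measure.restrict_apply hSm,
      Measure.restrict_apply MeasurableSet.univ, Set.univ_inter]
    rw [← hW]
    have h1 : W * (2 / M) ≤ η * β / 2 := by
      have : W * (2 / M) = (η * β / 2) * (W / (W + 1)) := by
        rw [hM]; field_simp; ring
      rw [this]
      have h2 : W / (W + 1) ≤ 1 := by rw [div_le_one (by positivity)]; linarith
      have h3 : 0 ≤ η * β / 2 := by positivity
      nlinarith
    linarith
end
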